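/- There is a function f : ℕ → ℕ such that the following holds: if m is a positive integer and G is a finite group in which every element g has a right Engel sink of cardinality at most m, then G has a normal subgroup N with |N| ≤ f(m) such that the quotient G/N is nilpotent. -/

import Mathlib

/-- The commutator `[a,b] = a⁻¹ b⁻¹ a b`. -/
def cmtr {G : Type*} [Group G] (a b : G) : G := a⁻¹ * b⁻¹ * a * b

/-- `engel a b n` is the left-normed Engel commutator `[a,_n b] = [[...[[a,b],b],...],b]`
with `b` repeated `n` times. -/
def engel {G : Type*} [Group G] (a b : G) : ℕ → G
  | 0 => a
  | n + 1 => cmtr (engel a b n) b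

/-- A finite subset `R` of `G` is a right Engel sink for `g` if for every `x ∈ G` there is a
positive integer `n₀` such that `[g,_n x] ∈ R` for all `n ≥ n₀`. -/
def IsRightEngelSink {G : Type*} [Group G] (g : G) (R : Set G) : Prop :=
  R.Finite ∧ ∀ x : G, ∃ n₀ : ℕ, 0 < n₀ ∧ ∀ n ≥ n₀, engel g x n ∈ R

/-- A finite subset `E` of `G` is a left Engel sink for `g` if for every `x ∈ G` there is a
positive integer `n₀` such that `[x,_n g] ∈ E` for all `n ≥ n₀`. -/
def IsLeftEngelSink {G : Type*} [Group G] (g : G) (E : Set G) : Prop :=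
  E.Finite ∧ ∀ x : G, ∃ n₀ : ℕ, 0 < n₀ ∧ ∀ n ≥ n₀, engel x g n ∈ E

/-- An element is almost right Engel if it admits a finite right Engel sink. -/
def AlmostRightEngel {G : Type*} [Group G] (g : G) : Prop :=
  ∃ R : Set G, IsRightEngelSink g R

/-- A group is locally nilpotent if every finitely generated subgroup is nilpotent. -/
def LocallyNilpotent (G : Type*) [Group G] : Prop :=
  ∀ H : Subgroup G, H.FG → Group.IsNilpotent H

universe u

/-- A uniform version of the sink condition: every element has a right Engel sink of size at
most `m`, entered by all sequences after a bounded number of steps. -/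
def HasSinks (m : ℕ) (G : Type*) [Group G] : Prop :=
  ∀ g : G, ∃ R : Finset G, R.card ≤ m ∧ ∃ N, ∀ x : G, ∀ n ≥ N, engel g x n ∈ R

section Engel

variable {G H : Type*} [Group G] [Group H]

theorem map_cmtr (f : G →* H) (a b : G) : f (cmtr a b) = cmtr (f a) (f b) := by
  simp [cmtr]

theorem map_engel (f : G →* H) (a b : G) (n : ℕ) : f (engel a b n) = engel (f a) (f b) n := by
  induction n with
  | zero => rfl
  | succ n ih => rw [engel, map_cmtr, ih, engel]

theorem engel_add (a b : G) (n k : ℕ) : engel a b (n + k) = engel (engel a b n) b k := by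
  induction k with
  | zero => rfl
  | succ k ih => rw [← add_assoc, engel, ih, engel]

theorem cmtr_eq_one_iff {a b : G} : cmtr a b = 1 ↔ a * b = b * a := by
  unfold cmtr
  constructor
  · intro h
    have : b * a * (a⁻¹ * b⁻¹ * a * b) = b * a * 1 := by rw [h]
    simpa [mul_assoc] using this
  · intro h
    rw [mul_assoc, h]
    group

theorem cmtr_one_left (x : G) : cmtr 1 x = 1 := by simp [cmtr]

theorem conj_engel (c a b : G) (n : ℕ) :
    c * engel a b n * c⁻¹ = engel (c * a * c⁻¹) (c * b * c⁻¹) n := by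
  simpa using map_engel (MulAut.conj c).toMonoidHom a b n

theorem engel_mem {K : Subgroup G} {a b : G} (ha : a ∈ K)
    (hK : ∀ k ∈ K, b⁻¹ * k * b ∈ K) (n : ℕ) : engel a b n ∈ K := by
  induction n with
  | zero => exact ha
  | succ n ih =>
    have := K.mul_mem (K.inv_mem ih) (hK _ ih)
    simpa [engel, cmtr, mul_assoc] using this

theorem HasSinks.of_injective {m : ℕ} (hG : HasSinks m G) (f : H →* G)
    (hf : Function.Injective f) : HasSinks m H := by
  classical
  intro g
  obtain ⟨R, hR, N, hN⟩ := hG (f g)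
  refine ⟨R.preimage f hf.injOn, (Finset.card_le_card_of_injOn f ?_ hf.injOn).trans hR, N, ?_⟩
  · intro x hx
    simpa using hx
  · intro x n hn
    simpa [map_engel] using hN (f x) n hn

theorem HasSinks.of_surjective {m : ℕ} (hG : HasSinks m G) (f : G →* H)
    (hf : Function.Surjective f) : HasSinks m H := by
  classical
  intro g
  obtain ⟨g, rfl⟩ := hf g
  obtain ⟨R, hR, N, hN⟩ := hG g
  refine ⟨R.image f, Finset.card_image_le.trans hR, N, ?_⟩
  intro x n hn
  obtain ⟨x, rfl⟩ := hf x
  rw [← map_engel]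
  exact Finset.mem_image_of_mem _ (hN x n hn)

theorem HasSinks.subgroup {m : ℕ} (hG : HasSinks m G) (K : Subgroup G) : HasSinks m K :=
  hG.of_injective K.subtype K.subtype_injective

theorem HasSinks.quotient {m : ℕ} (hG : HasSinks m G) (K : Subgroup G) [K.Normal] :
    HasSinks m (G ⧸ K) :=
  hG.of_surjective (QuotientGroup.mk' K) (QuotientGroup.mk'_surjective K)

theorem HasSinks.pos {m : ℕ} (hG : HasSinks m G) : 0 < m := by
  obtain ⟨R, hR, N, hN⟩ := hG 1
  exact (Finset.card_pos.2 ⟨_, hN 1 N le_rfl⟩).trans_le hR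

theorem hasSinks_of_isRightEngelSink [Finite G] {m : ℕ}
    (h : ∀ g : G, ∃ R : Finset G, R.card ≤ m ∧ IsRightEngelSink g (R : Set G)) :
    HasSinks m G := by
  intro g
  obtain ⟨R, hR, -, hs⟩ := h g
  choose N _ hN using hs
  obtain ⟨B, hB⟩ := (Set.finite_range N).bddAbove
  exact ⟨R, hR, B, fun x n hn => hN x n ((hB (Set.mem_range_self x)).trans hn)⟩

end Engel

section Counting

variable {G : Type*} [Group G]

theorem Subgroup.relIndex_le_of_map {α : Type*} {H D : Subgroup G} (f : G → α) (R : Finset α)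
    (hR : ∀ d ∈ D, f d ∈ R) (hf : ∀ d ∈ D, ∀ e ∈ D, f d = f e → d * e⁻¹ ∈ H) :
    H.relIndex D ≤ R.card := by
  classical
  have key : ∀ q : D ⧸ H.subgroupOf D, f ((q.out : D)⁻¹ : D) ∈ R := fun q => hR _ (SetLike.coe_mem _)
  have : Nat.card (D ⧸ H.subgroupOf D) ≤ Nat.card R := by
    refine Nat.card_le_card_of_injective (fun q => ⟨_, key q⟩) ?_
    intro q r h
    have h1 := hf _ (SetLike.coe_mem _) _ (SetLike.coe_mem _) (congrArg Subtype.val h)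
    rw [← q.out_eq', ← r.out_eq']
    refine QuotientGroup.eq.2 ?_
    simpa [Subgroup.mem_subgroupOf] using h1
  simpa [Subgroup.relIndex, Subgroup.index] using this

theorem mem_centralizer_singleton {x g : G} :
    g ∈ Subgroup.centralizer {x} ↔ g * x = x * g := by
  rw [Subgroup.mem_centralizer_singleton_iff]

end Counting

section PParts

variable {G : Type*} [Group G]

theorem exists_pParts [Finite G] (p : ℕ) [hp : Fact p.Prime] (g : G) :
    ∃ i j : ℕ, (∃ k, (g ^ i) ^ p ^ k = 1) ∧ p.Coprime (orderOf (g ^ j)) ∧ g ^ i * g ^ j = g := by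
  obtain ⟨k, r, hr, hk⟩ := Nat.exists_eq_pow_mul_and_not_dvd (orderOf_pos g).ne' p hp.out.ne_one
  have hc : Nat.Coprime (p ^ k) r := ((Nat.Prime.coprime_iff_not_dvd hp.out).2 hr).pow_left k
  obtain ⟨i, hi1, hi2⟩ := Nat.chineseRemainder hc 1 0
  obtain ⟨j, hj1, hj2⟩ := Nat.chineseRemainder hc 0 1
  refine ⟨i, j, ⟨k, ?_⟩, ?_, ?_⟩
  · rw [← pow_mul, ← orderOf_dvd_iff_pow_eq_one, hk, mul_comm]
    exact mul_dvd_mul ((Nat.modEq_zero_iff_dvd).1 hi2) dvd_rfl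
  · refine Nat.Coprime.coprime_dvd_right (?_ : _ ∣ r) ((Nat.Prime.coprime_iff_not_dvd hp.out).2 hr)
    rw [orderOf_dvd_iff_pow_eq_one, ← pow_mul, ← orderOf_dvd_iff_pow_eq_one, hk]
    exact mul_dvd_mul ((Nat.modEq_zero_iff_dvd).1 hj1) dvd_rfl
  · rw [← pow_add]
    conv_rhs => rw [← pow_one g]
    rw [pow_eq_pow_iff_modEq, hk]
    refine (Nat.modEq_and_modEq_iff_modEq_mul hc).1 ⟨?_, ?_⟩
    · simpa using hi1.add hj1
    · simpa using hi2.add hj2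

theorem eq_one_of_pow_eq_one_of_coprime {p : ℕ} {g : G} {k n : ℕ} (h1 : g ^ p ^ k = 1)
    (h2 : g ^ n = 1) (hc : p.Coprime n) : g = 1 := by
  have h := Nat.Coprime.pow_left k hc
  rw [← orderOf_eq_one_iff]
  exact Nat.eq_one_of_dvd_coprimes h (orderOf_dvd_of_pow_eq_one h1) (orderOf_dvd_of_pow_eq_one h2)

theorem isPGroup_zpowers {p : ℕ} {g : G} (hg : ∃ k, g ^ p ^ k = 1) :
    IsPGroup p (Subgroup.zpowers g) := by
  obtain ⟨k, hk⟩ := hg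
  rintro ⟨_, n, rfl⟩
  refine ⟨k, ?_⟩
  ext
  simp only [Subgroup.coe_pow, Subgroup.coe_one]
  rw [← zpow_natCast, zpow_comm, zpow_natCast, hk, one_zpow]

theorem IsPGroup.exists_pow_eq_one {p : ℕ} {P : Subgroup G} (hP : IsPGroup p P) {g : G}
    (hg : g ∈ P) : ∃ k, g ^ p ^ k = 1 := by
  obtain ⟨k, hk⟩ := hP ⟨g, hg⟩
  exact ⟨k, by simpa using congrArg Subtype.val hk⟩

theorem exists_mem_sylow {p : ℕ} {g : G} (hg : ∃ k, g ^ p ^ k = 1) :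
    ∃ P : Sylow p G, g ∈ P := by
  obtain ⟨P, hP⟩ := (isPGroup_zpowers hg).exists_le_sylow
  exact ⟨P, hP (Subgroup.mem_zpowers g)⟩

/-- The largest normal `p`-subgroup of a group. -/
def pcore (p : ℕ) (G : Type*) [Group G] : Subgroup G := ⨅ P : Sylow p G, (P : Subgroup G)

theorem mem_pcore {p : ℕ} {g : G} : g ∈ pcore p G ↔ ∀ P : Sylow p G, g ∈ P := by
  simp only [pcore, Subgroup.mem_iInf]; rfl

instance pcore_normal (p : ℕ) : (pcore p G).Normal := by
  refine ⟨fun n hn g => ?_⟩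
  rw [mem_pcore] at hn ⊢
  intro P
  have := hn (g⁻¹ • P)
  rw [← SetLike.mem_coe, Sylow.coe_smul] at this
  obtain ⟨x, hx, rfl⟩ := this
  simpa [mul_assoc] using hx

theorem isPGroup_pcore (p : ℕ) : IsPGroup p (pcore p G) := by
  obtain ⟨P⟩ : Nonempty (Sylow p G) := inferInstance
  exact P.isPGroup'.to_le (iInf_le _ P)

theorem le_pcore {p : ℕ} {N : Subgroup G} [N.Normal] [Finite G] (hN : IsPGroup p N) :
    N ≤ pcore p G :=
  le_iInf fun P => hN.le_sylow_of_normal P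

end PParts

section CoprimeAction

/-- If an automorphism of order prime to `p` of a finite `p`-group fixes `c` and two commutators
`[d, σ]`, `[e, σ]` differ by `c`, then `c = 1`. -/
theorem IsPGroup.eq_one_of_coprime_action {p : ℕ} [hp : Fact p.Prime] (s : ℕ) (hs : p.Coprime s) :
    ∀ (n : ℕ) (D : Type u) [Group D] [Finite D], Nat.card D = n → IsPGroup p D →
    ∀ σ : D ≃* D, (∀ d, σ^[s] d = d) → ∀ c d e : D, σ c = c →
    e⁻¹ * σ e = c * (d⁻¹ * σ d) → c = 1 := by
  intro n
  induction n using Nat.strong_induction_on with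
  | _ n ih =>
  intro D _ _ hn hD σ hσ c d e hc h
  rcases subsingleton_or_nontrivial D with hsub | hnt
  · exact Subsingleton.elim _ _
  have hcen : c ∈ Subgroup.center D := by
    have : Nontrivial (Subgroup.center D) := hD.center_nontrivial
    have hmap : (Subgroup.center D).map σ.toMonoidHom = Subgroup.center D :=
      Subgroup.characteristic_iff_map_eq.1 inferInstance σ
    let τ : D ⧸ Subgroup.center D ≃* D ⧸ Subgroup.center D :=
      QuotientGroup.congr _ _ σ hmap
    have hτ : ∀ x : D, τ (x : D ⧸ Subgroup.center D) = ((σ x : D) : D ⧸ Subgroup.center D) :=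
      fun x => rfl
    have hτi : ∀ (k : ℕ) (x : D), τ^[k] (x : D ⧸ Subgroup.center D) =
        ((σ^[k] x : D) : D ⧸ Subgroup.center D) := by
      intro k
      induction k with
      | zero => intro x; rfl
      | succ k ih => intro x; rw [Function.iterate_succ_apply, hτ, ih, Function.iterate_succ_apply]
    have hlt : Nat.card (D ⧸ Subgroup.center D) < n := by
      rw [← hn, Subgroup.card_eq_card_quotient_mul_card_subgroup (Subgroup.center D)]
      have h2 : 1 < Nat.card (Subgroup.center D) := Finite.one_lt_card
      have h3 : 0 < Nat.card (D ⧸ Subgroup.center D) := Nat.card_pos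
      nlinarith
    have := ih _ hlt (D ⧸ Subgroup.center D) rfl (hD.to_quotient _) τ
      (by
        intro x
        induction x using QuotientGroup.induction_on with
        | H x => rw [hτi, hσ])
      c d e (by rw [hτ, hc]) (by
        rw [hτ, hτ]
        exact_mod_cast congrArg (QuotientGroup.mk (s := Subgroup.center D)) h)
    rwa [QuotientGroup.eq_one_iff] at this
  rw [Subgroup.mem_center_iff] at hcen
  set f := e * d⁻¹ with hf
  have he : e = f * d := by simp [hf]
  have h1 : σ f = f * c := by
    have h3 : d⁻¹ * (f⁻¹ * σ f) * σ d = c * d⁻¹ * σ d := by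
      rw [he] at h
      simpa [mul_assoc] using h
    have h2 : d⁻¹ * (f⁻¹ * σ f) = c * d⁻¹ := mul_right_cancel h3
    rw [← hcen d⁻¹] at h2
    rw [← mul_left_cancel h2]
    group
  have h2 : ∀ k, σ^[k] f = f * c ^ k := by
    intro k
    induction k with
    | zero => simp
    | succ k ih =>
      rw [Function.iterate_succ_apply', ih, map_mul, map_pow, hc, h1, pow_succ', mul_assoc]
  have h3 : c ^ s = 1 := by simpa [hσ] using h2 s
  obtain ⟨k, hk⟩ := hD c
  exact eq_one_of_pow_eq_one_of_coprime hk h3 hs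

variable {G : Type*} [Group G]

theorem cmtr_eq_cmtr_iff {s t x : G} : cmtr s x = cmtr t x ↔ (t * s⁻¹) * x = x * (t * s⁻¹) := by
  unfold cmtr
  constructor
  · intro h
    have h1 : s⁻¹ * x⁻¹ * s = t⁻¹ * x⁻¹ * t := mul_right_cancel h
    have h2 : t * s⁻¹ * x⁻¹ = x⁻¹ * (t * s⁻¹) := by
      have : t * (s⁻¹ * x⁻¹ * s) * s⁻¹ = t * (t⁻¹ * x⁻¹ * t) * s⁻¹ := by rw [h1]
      simpa [mul_assoc] using this
    have h3 : x * (t * s⁻¹ * x⁻¹) * x = x * (x⁻¹ * (t * s⁻¹)) * x := by rw [h2]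
    simpa [mul_assoc] using h3.symm
  · intro h
    have h2 : x⁻¹ * (t * s⁻¹) = t * s⁻¹ * x⁻¹ := by
      have : x⁻¹ * (t * s⁻¹ * x) * x⁻¹ = x⁻¹ * (x * (t * s⁻¹)) * x⁻¹ := by rw [h]
      simpa [mul_assoc] using this
    have : t⁻¹ * (x⁻¹ * (t * s⁻¹)) * s * x = t⁻¹ * (t * s⁻¹ * x⁻¹) * s * x := by rw [h2]
    simpa [mul_assoc] using this.symm

theorem cmtr_mem {D : Subgroup G} {x d : G} (hn : ∀ d ∈ D, x⁻¹ * d * x ∈ D) (hd : d ∈ D) :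
    cmtr d x ∈ D := by
  simpa [cmtr, mul_assoc] using D.mul_mem (D.inv_mem hd) (hn d hd)

variable [Finite G] {p : ℕ} [hp : Fact p.Prime]

theorem IsPGroup.eq_one_of_cmtr_eq {D : Subgroup G} (hD : IsPGroup p D) {x : G}
    (hx : p.Coprime (orderOf x)) (hn : ∀ d ∈ D, x⁻¹ * d * x ∈ D) {c d e : G} (hc : c ∈ D)
    (hd : d ∈ D) (he : e ∈ D) (hcx : c * x = x * c) (h : cmtr e x = c * cmtr d x) : c = 1 := by
  have hinj : Function.Injective fun y : D => (⟨x⁻¹ * y * x, hn y y.2⟩ : D) := by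
    intro a b hab
    simpa using hab
  let τ : D →* D :=
    { toFun := fun y : D => (⟨x⁻¹ * y * x, hn y y.2⟩ : D)
      map_one' := by simp
      map_mul' := by intro a b; ext; simp [mul_assoc] }
  let σ : D ≃* D := MulEquiv.ofBijective τ
    (Finite.injective_iff_bijective.1 hinj)
  have hσ : ∀ y : D, ((σ y : D) : G) = x⁻¹ * y * x := fun y => rfl
  have hσi : ∀ (k : ℕ) (y : D), ((σ^[k] y : D) : G) = x⁻¹ ^ k * y * x ^ k := by
    intro k
    induction k with
    | zero => simp
    | succ k ih =>
      intro y
      rw [Function.iterate_succ_apply', hσ, ih, pow_succ x, pow_succ' x⁻¹]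
      simp only [mul_assoc]
  have := hD.eq_one_of_coprime_action (orderOf x) hx _ D rfl σ
    (by intro y; ext; rw [hσi]; simp [pow_orderOf_eq_one]) ⟨c, hc⟩ ⟨d, hd⟩ ⟨e, he⟩
    (by ext; rw [hσ]; simp [mul_assoc, hcx])
    (by ext; simpa [hσ, cmtr, mul_assoc] using h)
  simpa using congrArg Subtype.val this

/-- Commutators with a `p'`-element normalising a `p`-subgroup recur in Engel sequences. -/
theorem IsPGroup.exists_engel_cmtr_eq {D : Subgroup G} (hD : IsPGroup p D) {x : G}
    (hx : p.Coprime (orderOf x)) (hn : ∀ d ∈ D, x⁻¹ * d * x ∈ D) {d : G} (hd : d ∈ D) (N : ℕ) :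
    ∃ n ≥ N, engel (cmtr d x) x n = cmtr d x := by
  let S : Set G := (fun d => cmtr d x) '' (D : Set G)
  have hS : ∀ s ∈ S, s ∈ D := by
    rintro _ ⟨d, hd, rfl⟩
    exact cmtr_mem hn hd
  let φ : S → S := fun s => ⟨cmtr s x, s, hS _ s.2, rfl⟩
  have hφ : Function.Injective φ := by
    rintro ⟨_, d, hd, rfl⟩ ⟨_, e, he, rfl⟩ h
    have h1 : cmtr (cmtr d x) x = cmtr (cmtr e x) x := congrArg Subtype.val h
    rw [cmtr_eq_cmtr_iff] at h1
    have := hD.eq_one_of_cmtr_eq hx hn (D.mul_mem (cmtr_mem hn he) (D.inv_mem (cmtr_mem hn hd)))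
      hd he h1 (by group)
    ext
    exact (mul_inv_eq_one.1 this).symm
  have hφi : ∀ (k : ℕ) (s : S), ((φ^[k] s : S) : G) = engel (s : G) x k := by
    intro k
    induction k with
    | zero => intro s; rfl
    | succ k ih =>
      intro s
      rw [Function.iterate_succ_apply']
      change cmtr _ x = cmtr _ x
      rw [ih]
  let s : S := ⟨cmtr d x, d, hd, rfl⟩
  obtain ⟨k, hk, hper⟩ := hφ.mem_periodicPts s
  refine ⟨k * (N + 1), ?_, ?_⟩
  · have : 1 ≤ k := hk
    nlinarith
  · have h1 := hφi (k * (N + 1)) s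
    rw [(hper.mul_const (N + 1)).eq] at h1
    exact h1.symm

theorem IsPGroup.exists_finset_cmtr {m : ℕ} (hG : HasSinks m G) {D : Subgroup G}
    (hD : IsPGroup p D) {d : G} (hd : d ∈ D) :
    ∃ R : Finset G, R.card ≤ m ∧ ∀ x : G, p.Coprime (orderOf x) → x ∈ Subgroup.normalizer (D : Set G) →
      cmtr d x ∈ R := by
  obtain ⟨R, hR, N, hN⟩ := hG d
  refine ⟨R, hR, fun x hx hx' => ?_⟩
  have hn : ∀ d ∈ D, x⁻¹ * d * x ∈ D := fun d => (Subgroup.mem_normalizer_iff''.1 hx' d).1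
  obtain ⟨n, hnN, hn⟩ := hD.exists_engel_cmtr_eq hx hn hd N
  rw [← hn]
  have := hN x (1 + n) (by omega)
  rwa [engel_add] at this

theorem IsPGroup.relIndex_centralizer_le {m : ℕ} (hG : HasSinks m G) {D : Subgroup G}
    (hD : IsPGroup p D) {x : G} (hx : p.Coprime (orderOf x)) (hx' : x ∈ Subgroup.normalizer (D : Set G)) :
    (Subgroup.centralizer {x}).relIndex D ≤ m := by
  have hn : ∀ d ∈ D, x⁻¹ * d * x ∈ D := fun d => (Subgroup.mem_normalizer_iff''.1 hx' d).1
  obtain ⟨R, hR, N, hN⟩ := hG x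
  refine le_trans (Subgroup.relIndex_le_of_map (fun d => cmtr x (d⁻¹ * x * d)) R ?_ ?_) hR
  · intro d hd
    set w := d⁻¹ * x * d with hw
    have hwo : orderOf w = orderOf x := by
      have : w = MulAut.conj d⁻¹ x := by simp [hw]
      rw [this]
      exact MulEquiv.orderOf_eq _ _
    have hwn : ∀ e ∈ D, w⁻¹ * e * w ∈ D := by
      intro e he
      have := D.mul_mem (D.mul_mem (D.inv_mem hd)
        (hn _ (D.mul_mem (D.mul_mem hd he) (D.inv_mem hd)))) hd
      simpa [hw, mul_assoc] using this
    have h0 : w⁻¹ * x ∈ D := by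
      have := D.mul_mem (D.inv_mem hd) (hn d hd)
      simpa [hw, mul_assoc] using this
    obtain ⟨n, hnN, h⟩ := hD.exists_engel_cmtr_eq (hwo ▸ hx) hwn h0 N
    have h2 : cmtr (w⁻¹ * x) w = cmtr x w := by
      simp [cmtr, mul_assoc]
    rw [h2] at h
    have := hN w (1 + n) (by omega)
    rw [engel_add] at this
    change engel (cmtr x w) w n ∈ R at this
    rwa [h] at this
  · intro d hd e he h
    rw [mem_centralizer_singleton]
    have hn' : ∀ d ∈ D, x⁻¹⁻¹ * d * x⁻¹ ∈ D := fun d => by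
      simpa using (Subgroup.mem_normalizer_iff.1 hx' d).1
    have h1 : (d⁻¹ * x * d)⁻¹ * x * (d⁻¹ * x * d) = (e⁻¹ * x * e)⁻¹ * x * (e⁻¹ * x * e) := by
      simpa [cmtr, mul_assoc] using h
    have h2 : cmtr e x⁻¹ * (cmtr d x⁻¹)⁻¹ = 1 := by
      refine hD.eq_one_of_cmtr_eq (by simpa using hx) hn' (D.mul_mem (cmtr_mem hn' he)
        (D.inv_mem (cmtr_mem hn' hd))) hd he ?_ (by group)
      have h3 : cmtr e x⁻¹ * (cmtr d x⁻¹)⁻¹ = (e⁻¹ * x * e) * (d⁻¹ * x * d)⁻¹ := by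
        simp [cmtr, mul_assoc]
      have h4 : (e⁻¹ * x * e) * (d⁻¹ * x * d)⁻¹ * x = x * ((e⁻¹ * x * e) * (d⁻¹ * x * d)⁻¹) := by
        generalize d⁻¹ * x * d = w at h1
        generalize e⁻¹ * x * e = v at h1
        have : v * (w⁻¹ * x * w) * w⁻¹ = v * (v⁻¹ * x * v) * w⁻¹ := by rw [h1]
        simpa [mul_assoc] using this
      rw [h3]
      exact (Commute.inv_right (show Commute _ x from h4)).eq
    have h5 : cmtr e x⁻¹ = cmtr d x⁻¹ := mul_inv_eq_one.1 h2
    have h6 : Commute (d * e⁻¹) x⁻¹ := cmtr_eq_cmtr_iff.1 h5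
    simpa using h6.inv_right.eq

end CoprimeAction

section Baer

variable {G : Type*} [Group G]

theorem Sylow.mem_smul_iff {p : ℕ} {g x : G} {P : Sylow p G} : x ∈ g • P ↔ g⁻¹ * x * g ∈ P := by
  rw [← SetLike.mem_coe, Sylow.coe_smul, Set.mem_smul_set_iff_inv_smul_mem]
  simp [MulAut.smul_def, mul_assoc]

theorem sup_zpowers_isPGroup {p : ℕ} [Fact p.Prime] {T : Subgroup G} (hT : IsPGroup p T) {y : G}
    (hy : ∃ k, y ^ p ^ k = 1) (hn : y ∈ Subgroup.normalizer (T : Set G)) :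
    IsPGroup p (T ⊔ Subgroup.zpowers y : Subgroup G) :=
  hT.to_sup_of_normal_left' (isPGroup_zpowers hy) (by simpa using hn)

variable [Finite G] {p : ℕ} [hp : Fact p.Prime]

theorem Sylow.ncard_inter_eq {D : Set G} (hD : ∀ g, ∀ y ∈ D, g * y * g⁻¹ ∈ D) (P Q : Sylow p G) :
    (D ∩ P).ncard = (D ∩ Q).ncard := by
  have key : ∀ P Q : Sylow p G, (D ∩ P).ncard ≤ (D ∩ Q).ncard := by
    intro P Q
    obtain ⟨g, rfl⟩ := MulAction.exists_smul_eq G P Q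
    refine Set.ncard_le_ncard_of_injOn (fun y => g * y * g⁻¹) ?_ ?_ (Set.toFinite _)
    · rintro y ⟨hy, hyP⟩
      refine ⟨hD g y hy, ?_⟩
      change _ ∈ g • P
      rw [Sylow.mem_smul_iff]
      simpa [mul_assoc] using hyP
    · intro a _ b _ h
      simpa using h
  exact (key P Q).antisymm (key Q P)

theorem Sylow.exists_mem_normalizer {D : Set G} (hD : ∀ g, ∀ y ∈ D, g * y * g⁻¹ ∈ D)
    (P Q : Sylow p G) (h : ¬ D ∩ P ⊆ Q) :
    ∃ y ∈ D, y ∈ P ∧ y ∉ Q ∧ y ∈ Subgroup.normalizer (D ∩ P ∩ Q : Set G) := by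
  let S : Set (Subgroup G) := {T | T ≤ P ∧ D ∩ P ∩ Q ⊆ T ∧ D ∩ T ⊆ Q}
  have hS : ((P : Subgroup G) ⊓ Q) ∈ S := by
    refine ⟨inf_le_left, fun x hx => ⟨hx.1.2, hx.2⟩, fun x hx => hx.2.2⟩
  obtain ⟨T, hT⟩ := (Set.toFinite S).exists_maximal ⟨_, hS⟩
  obtain ⟨hTP, h1, h2⟩ := hT.prop
  have hlt : T < P := by
    refine lt_of_le_of_ne hTP ?_
    rintro rfl
    exact h h2
  have hnil : Group.IsNilpotent (P : Subgroup G) := P.isPGroup'.isNilpotent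
  have hlt' : T.subgroupOf P < ⊤ := by
    rw [lt_top_iff_ne_top, Ne, Subgroup.subgroupOf_eq_top]
    exact not_le_of_gt hlt
  have := Group.normalizerCondition_of_isNilpotent (T.subgroupOf P) hlt'
  obtain ⟨t, ht1, ht2⟩ := SetLike.exists_of_lt this
  rw [Subgroup.mem_normalizer_iff] at ht1
  have htn : (t : G) ∈ Subgroup.normalizer (T : Set G) := by
    rw [Subgroup.mem_normalizer_iff]
    intro x
    constructor
    · intro hx
      simpa [Subgroup.mem_subgroupOf] using (ht1 ⟨x, hTP hx⟩).1 hx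
    · intro hx
      have hxP : x ∈ (P : Subgroup G) := by
        have := P.mul_mem (P.mul_mem (P.inv_mem t.2) (hTP hx)) t.2
        simpa [mul_assoc] using this
      exact (ht1 ⟨x, hxP⟩).2 (by simpa [Subgroup.mem_subgroupOf] using hx)
  let T' := Subgroup.normalizer (T : Set G) ⊓ P
  have hTT' : T < T' := by
    refine lt_of_le_of_ne (le_inf Subgroup.le_normalizer hTP) ?_
    intro he
    have : (t : G) ∈ T' := ⟨htn, t.2⟩
    rw [← he] at this
    exact ht2 this
  have hT' : ¬ D ∩ T' ⊆ Q := by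
    intro h3
    exact hT.not_gt (show T' ∈ S from ⟨inf_le_right, h1.trans hTT'.le, h3⟩) hTT'
  rw [Set.not_subset] at hT'
  obtain ⟨y, ⟨hyD, hyn, hyP⟩, hyQ⟩ := hT'
  refine ⟨y, hyD, hyP, hyQ, ?_⟩
  have heq : D ∩ P ∩ Q = D ∩ T := by
    ext x
    exact ⟨fun hx => ⟨hx.1.1, h1 hx⟩, fun hx => ⟨⟨hx.1, hTP hx.2⟩, h2 hx⟩⟩
  rw [heq, Subgroup.mem_set_normalizer_iff]
  have hyn' := Subgroup.mem_normalizer_iff.1 hyn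
  intro x
  refine and_congr ⟨hD y x, fun hx => ?_⟩ (hyn' x)
  simpa [mul_assoc] using hD y⁻¹ _ hx

/-- **Baer's theorem** in the form: a normal subset of `p`-elements, each of which is a left Engel
element with respect to the others, lies in the largest normal `p`-subgroup. -/
theorem mem_pcore_of_engel {D : Set G} (hD : ∀ g, ∀ y ∈ D, g * y * g⁻¹ ∈ D)
    (hDp : ∀ y ∈ D, ∃ k, y ^ p ^ k = 1) (hE : ∀ y ∈ D, ∀ w ∈ D, ∃ n, engel w y n = 1)
    {y : G} (hy : y ∈ D) : y ∈ pcore p G := by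
  suffices h : ∀ P Q : Sylow p G, D ∩ P = D ∩ Q by
    obtain ⟨P, hP⟩ := exists_mem_sylow (hDp y hy)
    rw [mem_pcore]
    intro Q
    have : y ∈ D ∩ Q := by rw [← h P Q]; exact ⟨hy, hP⟩
    exact this.2
  by_contra! hne
  let S : Set (Sylow p G × Sylow p G) := {x | D ∩ x.1 ≠ D ∩ x.2}
  obtain ⟨⟨P, Q⟩, hPQ, hmax⟩ := (Set.toFinite S).exists_maximalFor
    (fun x => (D ∩ x.1 ∩ x.2).ncard) S (by obtain ⟨P, Q, h⟩ := hne; exact ⟨(P, Q), h⟩)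
  have hsub : ∀ P Q : Sylow p G, D ∩ P ⊆ Q → D ∩ P = D ∩ Q := fun P Q h =>
    Set.eq_of_subset_of_ncard_le (Set.subset_inter Set.inter_subset_left h)
      (Sylow.ncard_inter_eq hD Q P).le (Set.toFinite _)
  obtain ⟨y, hyD, hyP, hyQ, hyn⟩ := Sylow.exists_mem_normalizer hD P Q (fun h => hPQ (hsub _ _ h))
  obtain ⟨w, hwD, hwQ, hwP, hwn⟩ :=
    Sylow.exists_mem_normalizer hD Q P (fun h => hPQ (hsub _ _ h).symm)
  rw [Set.inter_right_comm] at hwn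
  set K := Subgroup.normalizer (D ∩ P : Set G) with hK
  have h1 : ∀ z ∈ D, z ∈ K → z ∈ P := by
    intro z hz hzK
    have hB : Subgroup.closure (D ∩ P : Set G) ≤ P := by
      rw [Subgroup.closure_le]; exact Set.inter_subset_right
    have hp2 := sup_zpowers_isPGroup (P.isPGroup'.to_le hB) (hDp z hz)
      (Subgroup.normalizer_le_normalizer_closure _ hzK)
    obtain ⟨P2, hP2⟩ := hp2.exists_le_sylow
    have : D ∩ P = D ∩ P2 := hsub _ _ fun x hx => hP2 (Subgroup.mem_sup_left
      (Subgroup.subset_closure hx))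
    have hz2 : z ∈ D ∩ P2 := ⟨hz, hP2 (Subgroup.mem_sup_right (Subgroup.mem_zpowers z))⟩
    rw [← this] at hz2
    exact hz2.2
  have hPK : ∀ z ∈ P, z ∈ K := by
    intro z hz
    rw [hK, Subgroup.mem_set_normalizer_iff]
    intro x
    refine and_congr ⟨hD z x, fun hx => ?_⟩ ⟨fun hx => P.mul_mem (P.mul_mem hz hx) (P.inv_mem hz),
      fun hx => ?_⟩
    · simpa [mul_assoc] using hD z⁻¹ _ hx
    · have h3 := P.mul_mem (P.mul_mem (P.inv_mem hz) hx) hz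
      simp only [mul_assoc, inv_mul_cancel_left, inv_mul_cancel, mul_one] at h3
      exact h3
  have h2 : ∀ u ∈ Subgroup.normalizer (D ∩ P ∩ Q : Set G), u⁻¹ * y * u ∈ P → u ∈ K := by
    intro u hu huP
    have heq : D ∩ P = D ∩ (u • P : Sylow p G) := by
      by_contra hcon
      have hss : D ∩ P ∩ Q ⊂ D ∩ P ∩ (u • P : Sylow p G) := by
        refine ⟨fun x hx => ⟨hx.1, ?_⟩, fun hss => hyQ (hss ⟨⟨hyD, hyP⟩, ?_⟩).2⟩
        · change x ∈ u • P
          rw [Sylow.mem_smul_iff]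
          have := (Subgroup.mem_set_normalizer_iff.1 (Subgroup.inv_mem _ hu) x).1 hx
          simpa using this.1.2
        · change y ∈ u • P
          rwa [Sylow.mem_smul_iff]
      have hlt := Set.ncard_lt_ncard hss (Set.toFinite _)
      have := hmax (j := (P, u • P)) hcon hlt.le
      exact absurd hlt (not_lt_of_ge this)
    rw [hK, Subgroup.mem_set_normalizer_iff]
    have hin : ∀ x, x ∈ D ∩ P → u * x * u⁻¹ ∈ D ∩ P := by
      intro x hx
      rw [heq]
      refine ⟨hD u x hx.1, ?_⟩
      change _ ∈ u • P
      rw [Sylow.mem_smul_iff]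
      simpa [mul_assoc] using hx.2
    intro x
    refine ⟨hin x, fun hx => ?_⟩
    rw [heq] at hx
    have h3 : u * x * u⁻¹ ∈ u • P := hx.2
    rw [Sylow.mem_smul_iff] at h3
    exact ⟨by simpa [mul_assoc] using hD u⁻¹ _ hx.1, by simpa [mul_assoc] using h3⟩
  have hH : ∀ i, engel w y i ∈ Subgroup.normalizer (D ∩ P ∩ Q : Set G) := fun i =>
    engel_mem hwn (fun k hk => Subgroup.mul_mem _ (Subgroup.mul_mem _ (Subgroup.inv_mem _ hyn) hk)
      hyn) i
  obtain ⟨n, hn⟩ := hE y hyD w hwD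
  have hdown : ∀ i, engel w y (n - i) ∈ K := by
    intro i
    induction i with
    | zero => simp [hn, K.one_mem]
    | succ i ih =>
      rcases le_or_gt n i with hle | hlt
      · rwa [show n - (i + 1) = n - i by omega]
      set u := engel w y (n - (i + 1)) with hu
      have hs : engel w y (n - i) = u⁻¹ * y⁻¹ * u * y := by
        rw [show n - i = (n - (i + 1)) + 1 by omega]; rfl
      rw [hs] at ih
      have h3 : u⁻¹ * y * u ∈ K := by
        have := K.inv_mem (K.mul_mem ih (K.inv_mem (hPK y hyP)))
        simpa [mul_assoc] using this
      refine h2 u (hH _) (h1 _ ?_ h3)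
      simpa using hD u⁻¹ y hyD
  have hw0 : w ∈ K := by simpa [engel] using hdown n
  exact hwP (h1 w hwD hw0)

end Baer

section BoundedSinks

open scoped Nat

section UpperCentral

variable {G : Type*} [Group G]

theorem cmtr_mem_upperCentralSeries {c : ℕ} {z : G}
    (hz : z ∈ Subgroup.upperCentralSeries G (c + 1)) (x : G) :
    cmtr z x ∈ Subgroup.upperCentralSeries G c := by
  have := Subgroup.mem_upperCentralSeries_succ_iff.1 (Subgroup.inv_mem _ hz) x⁻¹
  simpa [cmtr, commutatorElement_def] using this

theorem engel_eq_one_of_mem_upperCentralSeries {c : ℕ} {z : G}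
    (hz : z ∈ Subgroup.upperCentralSeries G c) (x : G) : engel z x c = 1 := by
  induction c generalizing z with
  | zero => simpa [engel, Subgroup.upperCentralSeries_zero] using hz
  | succ c ih =>
    rw [add_comm, engel_add]
    exact ih (cmtr_mem_upperCentralSeries hz x)

theorem inv_cmtr_mul_cmtr_mem {c : ℕ} {a b : G}
    (h : a⁻¹ * b ∈ Subgroup.upperCentralSeries G (c + 1)) (x : G) :
    (cmtr a x)⁻¹ * cmtr b x ∈ Subgroup.upperCentralSeries G c := by
  have h1 := cmtr_mem_upperCentralSeries h (a⁻¹ * x⁻¹ * a)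
  have h2 := Subgroup.Normal.conj_mem inferInstance _ (Subgroup.inv_mem _ h1) (x⁻¹)
  simpa [cmtr, mul_assoc] using h2

theorem engel_eq_engel_of_inv_mul_mem {c n : ℕ} {a b : G}
    (h : a⁻¹ * b ∈ Subgroup.upperCentralSeries G c) (x : G) (hn : c ≤ n) :
    engel a x n = engel b x n := by
  obtain ⟨k, rfl⟩ := Nat.exists_eq_add_of_le hn
  rw [engel_add, engel_add]
  congr 1
  clear hn
  induction c generalizing a b with
  | zero => simpa [engel, Subgroup.upperCentralSeries_zero, inv_mul_eq_one] using h
  | succ c ih =>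
    rw [add_comm, engel_add, engel_add]
    exact ih (inv_cmtr_mul_cmtr_mem h x)

theorem mem_pcore_of_mem_nilpotent [Finite G] {p : ℕ} [Fact p.Prime] {N : Subgroup G} [hN : N.Normal]
    (hE : ∀ z ∈ N, ∀ y ∈ N, ∃ c, engel z y c = 1) {e : G} (he : e ∈ N) (hp : ∃ k, e ^ p ^ k = 1) :
    e ∈ pcore p G := by
  refine mem_pcore_of_engel (D := {y | y ∈ N ∧ ∃ k, y ^ p ^ k = 1}) ?_ (fun y hy => hy.2)
    (fun y hy w hw => hE w hw.1 y hy.1) ⟨he, hp⟩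
  rintro g y ⟨hy, k, hk⟩
  exact ⟨hN.conj_mem y hy g, k, by rw [conj_pow, hk]; simp⟩

end UpperCentral

section FiniteIndices

variable {G : Type*} [Group G] [Finite G]

theorem Subgroup.relIndex_ne_zero_of_finite (H K : Subgroup G) : H.relIndex K ≠ 0 :=
  Subgroup.index_ne_zero_of_finite

theorem Subgroup.relIndex_anti_left {H K : Subgroup G} (h : H ≤ K) (L : Subgroup G) :
    K.relIndex L ≤ H.relIndex L :=
  Subgroup.relIndex_le_of_le_left h (Subgroup.relIndex_ne_zero_of_finite _ _)

theorem Subgroup.relIndex_mono_right (H : Subgroup G) {K L : Subgroup G} (h : K ≤ L) :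
    H.relIndex K ≤ H.relIndex L :=
  Subgroup.relIndex_le_of_le_right h (Subgroup.relIndex_ne_zero_of_finite _ _)

theorem Subgroup.relIndex_le_mul (U C L : Subgroup G) :
    U.relIndex L ≤ U.relIndex C * C.relIndex L := by
  calc U.relIndex L ≤ (U ⊓ C).relIndex L := Subgroup.relIndex_anti_left inf_le_left L
    _ = U.relIndex (C ⊓ L) * C.relIndex L := (Subgroup.relIndex_inf_mul_relIndex U C L).symm
    _ ≤ _ := Nat.mul_le_mul_right _ (Subgroup.relIndex_mono_right U inf_le_left)

theorem Subgroup.index_normalCore_le (H : Subgroup G) : H.normalCore.index ≤ H.index ! := by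
  rw [Subgroup.normalCore_eq_ker, Subgroup.index_ker, Subgroup.index_eq_card, ← Nat.card_perm]
  exact Nat.card_le_card_of_injective _ Subtype.val_injective

theorem Subgroup.exists_core (H L : Subgroup G) : ∃ N ≤ H, N ≤ L ∧
    L ≤ Subgroup.normalizer (N : Set G) ∧ N.relIndex L ≤ (H.relIndex L)! := by
  refine ⟨(H.subgroupOf L).normalCore.map L.subtype, ?_, Subgroup.map_subtype_le _, ?_, ?_⟩
  · rintro _ ⟨x, hx, rfl⟩
    exact (Subgroup.normalCore_le _ hx : x ∈ H.subgroupOf L)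
  · have := Subgroup.le_normalizer_map (H := (H.subgroupOf L).normalCore) L.subtype
    rw [Subgroup.normalizer_eq_top_iff.2 inferInstance] at this
    rwa [← MonoidHom.range_eq_map, Subgroup.range_subtype] at this
  · have : ((H.subgroupOf L).normalCore.map L.subtype).subgroupOf L = (H.subgroupOf L).normalCore :=
      Subgroup.comap_map_eq_self_of_injective L.subtype_injective _
    rw [Subgroup.relIndex, this]
    exact Subgroup.index_normalCore_le _

theorem Subgroup.mem_normalizer_of_conj_mem {H : Subgroup G} {x : G}
    (h : ∀ y ∈ H, x * y * x⁻¹ ∈ H) : x ∈ Subgroup.normalizer (H : Set G) := by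
  rw [Subgroup.mem_normalizer_iff]
  refine fun y => ⟨h y, fun hy => ?_⟩
  let f : H → H := fun y => ⟨x * y * x⁻¹, h y y.2⟩
  have hf : Function.Injective f := by
    intro a b hab
    simpa [f] using hab
  obtain ⟨⟨z, hz⟩, hzy⟩ := (Finite.injective_iff_surjective.1 hf) ⟨_, hy⟩
  have : x * z * x⁻¹ = x * y * x⁻¹ := congrArg Subtype.val hzy
  have : z = y := by simpa using this
  rwa [← this]

end FiniteIndices

/-- Finite groups with sinks of size at most `m` have a term of the upper central series of index
at most `h`. -/
def IndexBound (m h : ℕ) : Prop :=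
  ∀ (G : Type u) [Group G] [Finite G], HasSinks m G →
    ∃ c, (Subgroup.upperCentralSeries G c).index ≤ h

section NonEngelPair

variable {G : Type u} [Group G] [Finite G]

theorem hasSinks_centralizer_quotient {m : ℕ} (hG : HasSinks (m + 1) G) {q x : G}
    (hq : ∀ n, engel q x n ≠ 1) {N : ℕ} {C : Subgroup G}
    (hC : C = Subgroup.centralizer {z | ∃ n ≥ N, z = engel q x n})
    (hxC : x ∈ Subgroup.normalizer (C : Set G)) :
    HasSinks m (C ⧸ Subgroup.center C) := by
  classical
  have hcomm : ∀ c ∈ C, ∀ n ≥ N, c * engel q x n = engel q x n * c := by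
    intro c hc n hn
    rw [hC] at hc
    exact (Subgroup.mem_centralizer_iff.1 hc _ ⟨n, hn, rfl⟩).symm
  have hxc : ∀ d ∈ C, x⁻¹ * d * x ∈ C := fun d => (Subgroup.mem_normalizer_iff''.1 hxC d).1
  intro c'
  induction c' using QuotientGroup.induction_on with
  | H c =>
  obtain ⟨R1, hR1, N1, hN1⟩ := hG c
  obtain ⟨R2, hR2, N2, hN2⟩ := hG (engel q x N * c)
  let T : Set C := {s | (s : G) ∈ R1 ∧ (s : G) ∈ R2}
  let F : Finset C := T.toFinite.toFinset
  have hF : ∀ s : C, s ∈ F ↔ (s : G) ∈ R1 ∧ (s : G) ∈ R2 := fun s => by simp [F, T]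
  let π : C → C ⧸ Subgroup.center C := QuotientGroup.mk
  have himg : F.image Subtype.val ⊆ R1 ∩ R2 := by
    intro s hs
    obtain ⟨s, hs', rfl⟩ := Finset.mem_image.1 hs
    simpa using (hF s).1 hs'
  have hcardimg : (F.image Subtype.val).card = F.card :=
    Finset.card_image_of_injective _ Subtype.val_injective
  refine ⟨F.image π, ?_, max N1 N2 + 1, ?_⟩
  · by_contra! hlt
    have h1 : F.card ≤ (R1 ∩ R2).card := hcardimg ▸ Finset.card_le_card himg
    have h2 : (R1 ∩ R2).card ≤ R1.card := Finset.card_le_card Finset.inter_subset_left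
    have h2' : (R1 ∩ R2).card ≤ R2.card := Finset.card_le_card Finset.inter_subset_right
    have h3 : (F.image π).card ≤ F.card := Finset.card_image_le
    have hinj : Set.InjOn π F := Finset.card_image_iff.1 (by omega)
    have e1 : R1 ∩ R2 = R1 := Finset.eq_of_subset_of_card_le Finset.inter_subset_left (by omega)
    have e2 : R1 ∩ R2 = R2 := Finset.eq_of_subset_of_card_le Finset.inter_subset_right (by omega)
    have e3 : F.image Subtype.val = R1 ∩ R2 := Finset.eq_of_subset_of_card_le himg (by omega)
    have hcx : ∀ k, engel (c : G) x k ∈ C := fun k => engel_mem c.2 hxc k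
    have hmul : ∀ k, engel (engel q x N * c) x k = engel q x (N + k) * engel (c : G) x k := by
      intro k
      induction k with
      | zero => rfl
      | succ k ih =>
        have h4 := hcomm _ (hcx k) (N + (k + 1)) (by omega)
        rw [engel, ih]
        have h5 : engel q x (N + (k + 1)) = cmtr (engel q x (N + k)) x := rfl
        rw [h5] at h4 ⊢
        rw [engel]
        generalize engel q x (N + k) = z at *
        generalize engel (c : G) x k = r at *
        have h6 : r⁻¹ * cmtr z x = cmtr z x * r⁻¹ :=
          (Commute.inv_left (show Commute r (cmtr z x) from h4)).eq
        calc cmtr (z * r) x = r⁻¹ * cmtr z x * (x⁻¹ * r * x) := by simp [cmtr, mul_assoc]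
          _ = _ := by rw [h6]; simp [cmtr, mul_assoc]
    set k := max N1 N2
    have hr : engel (c : G) x k ∈ R1 := hN1 x k (le_max_left _ _)
    have hzr : engel q x (N + k) * engel (c : G) x k ∈ R2 := by
      rw [← hmul]; exact hN2 x k (le_max_right _ _)
    rw [← e1, ← e3, Finset.mem_image] at hr
    rw [← e2, ← e3, Finset.mem_image] at hzr
    obtain ⟨r, hrF, hr⟩ := hr
    obtain ⟨s, hsF, hs⟩ := hzr
    have hz : engel q x (N + k) = ((s * r⁻¹ : C) : G) := by
      rw [Subgroup.coe_mul, Subgroup.coe_inv, hr, hs]; group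
    have hcen : s * r⁻¹ ∈ Subgroup.center C := by
      rw [Subgroup.mem_center_iff]
      intro d
      refine Subtype.ext ?_
      rw [Subgroup.coe_mul _ d, Subgroup.coe_mul _ _ d, ← hz]
      exact hcomm _ d.2 _ (by omega)
    have heq : r⁻¹ * s ∈ Subgroup.center C := by
      have := Subgroup.Normal.conj_mem inferInstance _ hcen r⁻¹
      simpa [mul_assoc] using this
    have := hinj hrF hsF (QuotientGroup.eq.2 heq)
    apply hq (N + k)
    rw [hz, this]
    simp
  · intro y' n hn
    induction y' using QuotientGroup.induction_on with
    | H y =>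
    have h1 : engel (c : C ⧸ Subgroup.center C) (y : C ⧸ Subgroup.center C) n =
      π (engel c y n) := (map_engel (QuotientGroup.mk' (Subgroup.center C)) c y n).symm
    rw [h1]
    refine Finset.mem_image_of_mem _ ((hF _).2 ?_)
    have h2 : ((engel c y n : C) : G) = engel (c : G) y n := map_engel C.subtype c y n
    rw [h2]
    refine ⟨hN1 y n (by omega), ?_⟩
    have h3 : engel (engel q x N * c) (y : G) n = engel (c : G) y n := by
      obtain ⟨j, rfl⟩ := Nat.exists_eq_add_of_le (show 1 ≤ n by omega)
      rw [engel_add, engel_add]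
      congr 1
      change cmtr _ _ = cmtr _ _
      have h4 := hcomm y y.2 N le_rfl
      have h5 : (engel q x N)⁻¹ * (y : G)⁻¹ * engel q x N = (y : G)⁻¹ := by
        have h7 : Commute ((y : G)⁻¹) (engel q x N) :=
          Commute.inv_left (show Commute (y : G) _ from h4)
        rw [mul_assoc, h7.eq]; simp
      calc cmtr (engel q x N * c) (y : G)
          = (c : G)⁻¹ * ((engel q x N)⁻¹ * (y : G)⁻¹ * engel q x N) * c * y := by
            simp [cmtr, mul_assoc]
        _ = cmtr (c : G) y := by rw [h5]; simp [cmtr]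
    rw [← h3]
    exact hN2 y n (by omega)

theorem exists_nilpotent_of_engel_ne_one {m h : ℕ} (hG : HasSinks (m + 1) G)
    (hT : IndexBound.{u} m h) {q x : G} (hq : ∀ n, engel q x n ≠ 1) :
    ∃ (U : Subgroup G) (c : ℕ), x ∈ Subgroup.normalizer (U : Set G) ∧
      (∀ z ∈ U, ∀ y ∈ U, engel z y c = 1) ∧
      U.relIndex (Subgroup.centralizer {q}) ≤ h * (m + 1) ^ (m + 1) := by
  classical
  obtain ⟨R, hR, N, hN⟩ := hG q
  set Z : Set G := {z | ∃ n ≥ N, z = engel q x n} with hZ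
  have hZR : Z ⊆ R := by
    rintro _ ⟨n, hn, rfl⟩
    exact hN x n hn
  set C := Subgroup.centralizer Z with hC
  have hxC : x ∈ Subgroup.normalizer (C : Set G) := by
    refine Subgroup.mem_normalizer_of_conj_mem fun c hc => ?_
    rw [hC, Subgroup.mem_centralizer_iff] at hc ⊢
    rintro _ ⟨n, hn, rfl⟩
    have h1 := hc _ ⟨n, hn, rfl⟩
    have h2 := hc _ ⟨n + 1, by omega, rfl⟩
    have h3 : x⁻¹ * engel q x n * x = engel q x n * engel q x (n + 1) := by
      simp [engel, cmtr, mul_assoc]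
    have h4 : Commute (x⁻¹ * engel q x n * x) c := by
      rw [h3]; exact Commute.mul_left h1 h2
    have h5 := congrArg (fun t => x * t * x⁻¹) h4.eq
    simpa [mul_assoc] using h5
  have hrel : C.relIndex (Subgroup.centralizer {q}) ≤ (m + 1) ^ (m + 1) := by
    have : Fintype Z := Fintype.ofFinite Z
    have hcard : Fintype.card Z ≤ m + 1 := by
      rw [← Nat.card_eq_fintype_card, Nat.card_coe_set_eq]
      exact (Set.ncard_le_ncard hZR (Set.toFinite _)).trans (by rwa [Set.ncard_coe_finset])
    refine (Subgroup.relIndex_le_of_map (fun (d : G) (z : Z) => d⁻¹ * (z : G) * d)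
      (Fintype.piFinset fun _ => R) ?_ ?_).trans ?_
    · intro d hd
      rw [mem_centralizer_singleton] at hd
      rw [Fintype.mem_piFinset]
      rintro ⟨_, n, hn, rfl⟩
      have h1 := conj_engel d⁻¹ q x n
      simp only [inv_inv] at h1
      have h2 : d⁻¹ * q * d = q := by rw [mul_assoc, ← hd]; simp
      rw [h2] at h1
      change d⁻¹ * engel q x n * d ∈ R
      rw [h1]
      exact hN _ n hn
    · intro d hd e he h
      rw [hC, Subgroup.mem_centralizer_iff]
      intro z hz
      have h1 : d⁻¹ * z * d = e⁻¹ * z * e := congrFun h ⟨z, hz⟩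
      have h2 : d * (d⁻¹ * z * d) * e⁻¹ = d * (e⁻¹ * z * e) * e⁻¹ := by rw [h1]
      simpa [mul_assoc] using h2
    · rw [Fintype.card_piFinset]
      simp only [Finset.prod_const, Finset.card_univ]
      exact (Nat.pow_le_pow_left hR _).trans (Nat.pow_le_pow_right (by omega) hcard)
  obtain ⟨c, hc⟩ := hT _ (hasSinks_centralizer_quotient hG hq hC hxC)
  have hc' : (Subgroup.upperCentralSeries C (c + 1)).index ≤ h := by
    rw [← Subgroup.comap_upperCentralSeries_quotient_center,
      Subgroup.index_comap_of_surjective _ (QuotientGroup.mk'_surjective _)]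
    exact hc
  refine ⟨(Subgroup.upperCentralSeries C (c + 1)).map C.subtype, c + 1, ?_, ?_, ?_⟩
  · refine Subgroup.mem_normalizer_of_conj_mem ?_
    rintro _ ⟨z, hz, rfl⟩
    let σ : C ≃* C := C.normalizerMonoidHom ⟨x, hxC⟩
    have h1 : σ z ∈ Subgroup.upperCentralSeries C (c + 1) := by
      have := (Subgroup.characteristic_iff_map_eq.1
        (inferInstance : (Subgroup.upperCentralSeries C (c + 1)).Characteristic)) σ
      rw [← this]
      exact Subgroup.mem_map_of_mem _ hz
    exact ⟨σ z, h1, rfl⟩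
  · rintro _ ⟨z, hz, rfl⟩ _ ⟨y, hy, rfl⟩
    rw [← map_engel, engel_eq_one_of_mem_upperCentralSeries hz, map_one]
  · refine (Subgroup.relIndex_le_mul _ C _).trans (Nat.mul_le_mul ?_ hrel)
    rw [Subgroup.relIndex, Subgroup.subgroupOf,
      Subgroup.comap_map_eq_self_of_injective C.subtype_injective]
    exact hc'

end NonEngelPair

section GroupLemmas

theorem Subgroup.card_sup_le {G : Type*} [Group G] [Finite G] (H K : Subgroup G) [K.Normal] :
    Nat.card (H ⊔ K : Subgroup G) ≤ Nat.card H * Nat.card K := by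
  have h := Subgroup.relIndex_mul_relIndex ⊥ K (H ⊔ K) bot_le le_sup_right
  rw [Subgroup.relIndex_bot_left, Subgroup.relIndex_bot_left, Subgroup.relIndex_sup_right] at h
  rw [← h, mul_comm]
  refine Nat.mul_le_mul_right _ ?_
  exact Nat.le_of_dvd Nat.card_pos (Subgroup.relIndex_dvd_card K H)

theorem card_closure_le_of_orderOf_le {A : Type*} [CommGroup A] [Finite A] {e : ℕ} (S : Finset A)
    (hS : ∀ s ∈ S, orderOf s ≤ e) : Nat.card (Subgroup.closure (S : Set A)) ≤ e ^ S.card := by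
  classical
  induction S using Finset.induction_on with
  | empty => simp
  | insert a S ha ih =>
    rw [Finset.card_insert_of_notMem ha, pow_succ', Finset.coe_insert, Set.insert_eq,
      Subgroup.closure_union, ← Subgroup.zpowers_eq_closure]
    refine (Subgroup.card_sup_le _ _).trans (Nat.mul_le_mul ?_ ?_)
    · rw [Nat.card_zpowers]; exact hS a (Finset.mem_insert_self _ _)
    · exact ih fun s hs => hS s (Finset.mem_insert_of_mem hs)

theorem card_le_pow_of_sylow_le {A : Type*} [Group A] [Finite A] {b k : ℕ} (hb : 0 < b)
    (hk : ∀ p, p.Prime → p ∣ Nat.card A → p ≤ k)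
    (h : ∀ p, p.Prime → ∀ P : Sylow p A, Nat.card P ≤ b) : Nat.card A ≤ b ^ (k + 1) := by
  have hprod := Nat.prod_factorization_pow_eq_self (n := Nat.card A) Nat.card_pos.ne'
  conv_lhs => rw [← hprod]
  rw [Finsupp.prod]
  calc _ ≤ ∏ p ∈ (Nat.card A).factorization.support, b := by
        refine Finset.prod_le_prod' fun p hp => ?_
        have hp' : p.Prime := Nat.prime_of_mem_primeFactors hp
        have : Fact p.Prime := ⟨hp'⟩
        obtain ⟨P⟩ : Nonempty (Sylow p A) := inferInstance
        rw [← P.card_eq_multiplicity]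
        exact h p hp' P
    _ = b ^ (Nat.card A).primeFactors.card := by simp
    _ ≤ b ^ (k + 1) := by
        refine Nat.pow_le_pow_right hb ?_
        rw [← Finset.card_range (k + 1)]
        refine Finset.card_le_card fun p hp => ?_
        rw [Finset.mem_range, Nat.lt_succ_iff]
        exact hk p (Nat.prime_of_mem_primeFactors hp) (Nat.dvd_of_mem_primeFactors hp)

variable {G : Type*} [Group G] [Finite G] {p : ℕ} [hp : Fact p.Prime]

theorem IsPGroup.exists_fixed_of_le_normalizer {P N : Subgroup G} (hP : IsPGroup p P)
    (hN : IsPGroup p N) (hne : N ≠ ⊥) (h : P ≤ Subgroup.normalizer (N : Set G)) :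
    ∃ e ∈ N, e ≠ 1 ∧ ∀ x ∈ P, e * x = x * e := by
  let ψ : P →* MulAut N := N.normalizerMonoidHom.comp (Subgroup.inclusion h)
  let _ : MulAction P N := MulAction.compHom N ψ
  have hsm : ∀ (x : P) (e : N), ((x • e : N) : G) = x * e * (x : G)⁻¹ := fun x e => rfl
  have hd : p ∣ Nat.card N := by
    have : Nontrivial N := (Subgroup.nontrivial_iff_ne_bot N).2 hne
    obtain ⟨n, hn, hc⟩ := hN.nontrivial_iff_card.1 this
    rw [hc]
    exact dvd_pow_self p hn.ne'
  obtain ⟨e, he, hne⟩ := hP.exists_fixed_point_of_prime_dvd_card_of_fixed_point N hd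
    (a := 1) (by intro x; ext; simp [hsm])
  refine ⟨e, e.2, ?_, ?_⟩
  · intro h1
    exact hne (Subtype.ext h1.symm)
  · intro x hx
    have := congrArg Subtype.val (he ⟨x, hx⟩)
    rw [hsm] at this
    have h2 : x * e * x⁻¹ * x = e * x := by rw [this]
    simpa using h2.symm

theorem IsPGroup.exists_central {P D : Subgroup G} (hP : IsPGroup p P) {n : ℕ}
    (h : D.relIndex P ≤ n) (hn : n ! < Nat.card P) :
    ∃ e ∈ D, e ∈ P ∧ e ≠ 1 ∧ ∀ x ∈ P, e * x = x * e := by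
  obtain ⟨N, hND, hNP, hnorm, hrel⟩ := Subgroup.exists_core D P
  have hne : N ≠ ⊥ := by
    rintro rfl
    rw [Subgroup.relIndex_bot_left] at hrel
    have := Nat.factorial_le h
    omega
  obtain ⟨e, he, h1, h2⟩ := hP.exists_fixed_of_le_normalizer (hP.to_le hNP) hne hnorm
  exact ⟨e, hND he, hNP he, h1, h2⟩

theorem IsPGroup.exists_engel_eq_one {P : Subgroup G} (hP : IsPGroup p P) {a x : G}
    (ha : a ∈ P) (hx : x ∈ P) : ∃ n, engel a x n = 1 := by
  have hnil : Group.IsNilpotent P := hP.isNilpotent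
  obtain ⟨n, hn⟩ := hnil.nilpotent'
  refine ⟨n, ?_⟩
  have h1 : (⟨a, ha⟩ : P) ∈ Subgroup.upperCentralSeries P n := by rw [hn]; trivial
  have := engel_eq_one_of_mem_upperCentralSeries h1 ⟨x, hx⟩
  simpa using (map_engel P.subtype ⟨a, ha⟩ ⟨x, hx⟩ n).symm.trans (congrArg P.subtype this)

theorem MonoidHom.card_le_pow_of_iterate_eq_one {A : Type*} [CommGroup A] [Finite A] (f : A →* A)
    {v k : ℕ} (hv : Nat.card f.ker ≤ v) (hk : ∀ a, f^[k] a = 1) : Nat.card A ≤ v ^ k := by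
  have key : ∀ k, Nat.card {a : A // f^[k] a = 1} ≤ v ^ k := by
    intro k
    induction k with
    | zero => simp
    | succ k ih =>
      let F : {a : A // f^[k + 1] a = 1} → {a : A // f^[k] a = 1} := fun a => ⟨f a, a.2⟩
      have hfib : ∀ b, Nat.card {a // F a = b} ≤ v := by
        intro b
        rcases isEmpty_or_nonempty {a // F a = b} with he | ⟨⟨a0, ha0⟩⟩
        · rw [Nat.card_of_isEmpty]; exact Nat.zero_le _
        refine (Nat.card_le_card_of_injective
          (fun a => (⟨a.1.1 * (a0.1)⁻¹, ?_⟩ : f.ker)) ?_).trans hv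
        · have h1 : f a.1.1 = b.1 := congrArg Subtype.val a.2
          have h2 : f a0.1 = b.1 := congrArg Subtype.val ha0
          rw [MonoidHom.mem_ker, map_mul, map_inv, h1, h2, mul_inv_cancel]
        · intro a c hac
          have : a.1.1 * (a0.1)⁻¹ = c.1.1 * (a0.1)⁻¹ := congrArg Subtype.val hac
          exact Subtype.ext (Subtype.ext (mul_right_cancel this))
      have e := Nat.card_congr (Equiv.sigmaFiberEquiv F).symm
      have := Fintype.ofFinite {a : A // f^[k] a = 1}
      rw [e, Nat.card_sigma]
      calc _ ≤ ∑ _b : {a : A // f^[k] a = 1}, v := Finset.sum_le_sum fun b _ => hfib b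
        _ = Nat.card {a : A // f^[k] a = 1} * v := by simp
        _ ≤ v ^ k * v := Nat.mul_le_mul_right _ ih
        _ = v ^ (k + 1) := (pow_succ _ _).symm
  have := key k
  rwa [Nat.card_congr (Equiv.subtypeUnivEquiv hk)] at this

/-- A finite abelian group of bounded exponent acted on unipotently by an automorphism of bounded
order with few fixed points is small. -/
theorem card_le_of_unipotent {A : Type*} [CommGroup A] [Finite A] (σ : A →* A) {j v : ℕ}
    (hA : ∀ a : A, orderOf a ≤ j) {t : ℕ} (ht0 : 0 < t) (htj : t ≤ j) (ht : ∀ a, σ^[t] a = a)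
    (hv : {a | σ a = a}.ncard ≤ v) (hu : ∀ a, ∃ n, (fun b => b⁻¹ * σ b)^[n] a = 1) :
    Nat.card A ≤ v ^ j ^ j := by
  classical
  let f : A →* A :=
    { toFun := fun b => b⁻¹ * σ b
      map_one' := by simp
      map_mul' := by intro a b; simp only [mul_inv, map_mul]; exact mul_mul_mul_comm _ _ _ _ }
  refine f.card_le_pow_of_iterate_eq_one ?_ ?_
  · rw [← SetLike.coe_sort_coe, Nat.card_coe_set_eq]
    refine le_trans (le_of_eq ?_) hv
    congr 1
    ext a
    change a⁻¹ * σ a = 1 ↔ σ a = a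
    rw [inv_mul_eq_one, eq_comm]
  · intro a
    set S : Finset A := (Finset.range t).image fun i => σ^[i] a with hS
    set B := Subgroup.closure (S : Set A) with hB
    have hj : 0 < j := ht0.trans_le htj
    have hBcard : Nat.card B ≤ j ^ j := by
      refine (card_closure_le_of_orderOf_le S fun s _ => hA s).trans (Nat.pow_le_pow_right hj ?_)
      exact (Finset.card_image_le.trans (by simp)).trans htj
    have hσB : ∀ b ∈ B, σ b ∈ B := by
      intro b hb
      have : B ≤ B.comap σ := by
        rw [hB, Subgroup.closure_le]
        intro s hs
        obtain ⟨i, hi, rfl⟩ := Finset.mem_image.1 hs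
        rw [Finset.mem_range] at hi
        refine Subgroup.subset_closure ?_
        rw [← Function.iterate_succ_apply' σ]
        rcases Nat.lt_or_ge (i + 1) t with h | h
        · exact Finset.mem_image.2 ⟨i + 1, Finset.mem_range.2 h, rfl⟩
        · have : i + 1 = t := by omega
          exact Finset.mem_image.2 ⟨0, Finset.mem_range.2 ht0, by simp [this, ht]⟩
      exact this hb
    have haB : a ∈ B := Subgroup.subset_closure (Finset.mem_image.2
      ⟨0, Finset.mem_range.2 ht0, rfl⟩)
    have hfB : ∀ i, f^[i] a ∈ B := by
      intro i
      induction i with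
      | zero => exact haB
      | succ i ih =>
        rw [Function.iterate_succ_apply']
        exact B.mul_mem (B.inv_mem ih) (hσB _ ih)
    by_contra hne
    obtain ⟨n, hn⟩ := hu a
    have hn' : f^[n] a = 1 := hn
    have hinj : Function.Injective fun i : Fin (j ^ j + 1) => (⟨f^[i] a, hfB i⟩ : B) := by
      intro i k hik
      by_contra hne2
      wlog hlt : i < k generalizing i k
      · exact this hik.symm (Ne.symm hne2) (lt_of_le_of_ne (not_lt.1 hlt) (Ne.symm hne2))
      have h1 : f^[(i : ℕ)] a = f^[(k : ℕ)] a := congrArg Subtype.val hik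
      obtain ⟨d, hd⟩ := Nat.exists_eq_add_of_lt (show (i : ℕ) < k from hlt)
      have h2 : ∀ s, f^[(i : ℕ)] a = f^[(i + s * (d + 1) : ℕ)] a := by
        intro s
        induction s with
        | zero => simp
        | succ s ih =>
          rw [show (i + (s + 1) * (d + 1) : ℕ) = s * (d + 1) + (i + d + 1) by ring,
            Function.iterate_add_apply, ← hd, ← h1, ← Function.iterate_add_apply, add_comm (s * (d + 1))]
          exact ih
      have hge : n ≤ i + n * (d + 1) := by nlinarith
      have h3 : ∀ r s, r ≤ s → f^[r] a = 1 → f^[s] a = 1 := by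
        intro r s hrs hr
        obtain ⟨q, rfl⟩ := Nat.exists_eq_add_of_le hrs
        rw [add_comm, Function.iterate_add_apply, hr]
        exact Function.iterate_fixed (map_one f) q
      have h4 := h2 n
      rw [h3 _ _ hge hn'] at h4
      exact hne (h3 _ _ (by omega) h4)
    have := Nat.card_le_card_of_injective _ hinj
    rw [Nat.card_fin] at this
    omega

theorem exists_maximal_normal_commutative {P : Type*} [Group P] [Finite P] :
    ∃ A : Subgroup P, Maximal (fun A : Subgroup P => A.Normal ∧ IsMulCommutative A) A :=
  (Set.toFinite {A : Subgroup P | A.Normal ∧ IsMulCommutative A}).exists_maximal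
    ⟨⊥, inferInstance, inferInstance⟩

theorem IsPGroup.centralizer_le_of_maximal {P : Type*} [Group P] [Finite P] (hP : IsPGroup p P)
    {A : Subgroup P} (hA : Maximal (fun A : Subgroup P => A.Normal ∧ IsMulCommutative A) A) :
    Subgroup.centralizer (A : Set P) ≤ A := by
  obtain ⟨hAn, hAc⟩ := hA.prop
  by_contra hle
  set C := Subgroup.centralizer (A : Set P) with hC
  have hCn : C.Normal := inferInstance
  let π := QuotientGroup.mk' A
  have hne : C.map π ≠ ⊥ := by
    rw [Ne, Subgroup.map_eq_bot_iff, QuotientGroup.ker_mk']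
    exact hle
  have hQ : IsPGroup p (P ⧸ A) := hP.to_quotient A
  have hn : (⊤ : Subgroup (P ⧸ A)) ≤ Subgroup.normalizer (C.map π : Set (P ⧸ A)) := by
    rw [Subgroup.normalizer_eq_top_iff.2 (hCn.map π (QuotientGroup.mk'_surjective A))]
  obtain ⟨e, ⟨c, hcC, rfl⟩, hc1, hc2⟩ := IsPGroup.exists_fixed_of_le_normalizer
    (hQ.to_subgroup ⊤) (hQ.to_subgroup (C.map π)) hne hn
  have hcA : c ∉ A := fun h => hc1 ((QuotientGroup.eq_one_iff c).2 h)
  let B := A ⊔ Subgroup.zpowers c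
  have hcen : ∀ x : P, x * c * x⁻¹ ∈ B := by
    intro x
    have h1 := hc2 (π x) trivial
    have h2 : c⁻¹ * (x * c * x⁻¹) ∈ A := by
      rw [← QuotientGroup.eq_one_iff]
      change π (c⁻¹ * (x * c * x⁻¹)) = 1
      rw [map_mul, map_mul, map_mul, ← h1]
      simp
    have h3 := B.mul_mem (Subgroup.mem_sup_right (Subgroup.mem_zpowers c))
      (Subgroup.mem_sup_left h2 : _ ∈ B)
    simpa using h3
  have hBn : B.Normal := by
    have hB : B = Subgroup.closure ((A : Set P) ∪ {c}) := by
      rw [Subgroup.closure_union, Subgroup.closure_eq, ← Subgroup.zpowers_eq_closure]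
    rw [← Subgroup.normalizer_eq_top_iff, eq_top_iff]
    intro x _
    refine Subgroup.mem_normalizer_of_conj_mem fun y hy => ?_
    have hle : B ≤ B.comap (MulAut.conj x).toMonoidHom := by
      conv_lhs => rw [hB]
      rw [Subgroup.closure_le]
      rintro s (hs | rfl)
      · exact Subgroup.mem_sup_left (hAn.conj_mem s hs x)
      · exact hcen x
    exact hle hy
  have hBc : IsMulCommutative B := by
    have hB : B = Subgroup.closure ((A : Set P) ∪ {c}) := by
      rw [Subgroup.closure_union, Subgroup.closure_eq, ← Subgroup.zpowers_eq_closure]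
    rw [hB]
    refine Subgroup.isMulCommutative_closure ?_
    have hcomm : ∀ a ∈ A, a * c = c * a := fun a ha => Subgroup.mem_centralizer_iff.1 hcC a ha
    rintro x (hx | rfl) y (hy | rfl)
    · have := hAc.is_comm.comm ⟨x, hx⟩ ⟨y, hy⟩
      exact congrArg Subtype.val this
    · exact hcomm x hx
    · exact (hcomm y hy).symm
    · rfl
  have := hA.le_of_ge ⟨hBn, hBc⟩ le_sup_left
  exact hcA (this (Subgroup.mem_sup_right (Subgroup.mem_zpowers c)))

theorem IsPGroup.card_le_of_card_centralizer_le {P : Type*} [Group P] [Finite P]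
    (hP : IsPGroup p P) {j v : ℕ} (hj : ∀ g : P, orderOf g ≤ j) (y : P)
    (hy : Nat.card (Subgroup.centralizer {y}) ≤ v) :
    Nat.card P ≤ v ^ j ^ j * (v ^ j ^ j)! := by
  obtain ⟨A, hA⟩ := exists_maximal_normal_commutative (P := P)
  have hC := hP.centralizer_le_of_maximal hA
  obtain ⟨hAn, hAc⟩ := hA.prop
  have hcardA : Nat.card A ≤ v ^ j ^ j := by
    let _ : CommGroup A :=
      { (inferInstance : Group A) with mul_comm := hAc.is_comm.comm }
    let σ : A →* A := (MulAut.conjNormal y⁻¹ : MulAut A).toMonoidHom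
    have hσ : ∀ a : A, ((σ a : A) : P) = y⁻¹ * a * y := fun a => by
      change ((MulAut.conjNormal y⁻¹ a : A) : P) = _
      rw [MulAut.conjNormal_apply, inv_inv]
    have hσi : ∀ (i : ℕ) (a : A), ((σ^[i] a : A) : P) = y⁻¹ ^ i * a * y ^ i := by
      intro i
      induction i with
      | zero => simp
      | succ i ih =>
        intro a
        rw [Function.iterate_succ_apply', hσ, ih, pow_succ y, pow_succ' y⁻¹]
        simp only [mul_assoc]
    refine card_le_of_unipotent (A := A) σ (j := j) ?_ (t := orderOf y) (orderOf_pos y) (hj y) ?_ ?_ ?_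
    · intro a
      rw [← Subgroup.orderOf_coe]
      exact hj a
    · intro a
      ext
      rw [hσi]
      simp [pow_orderOf_eq_one]
    · refine le_trans ?_ hy
      change _ ≤ Nat.card (Subgroup.centralizer {y} : Set P)
      rw [Nat.card_coe_set_eq]
      refine Set.ncard_le_ncard_of_injOn (fun a : A => (a : P)) ?_
        (Subtype.val_injective.injOn) (Set.toFinite _)
      intro a ha
      have h1 : y⁻¹ * (a : P) * y = a := by rw [← hσ]; exact congrArg Subtype.val ha
      change (a : P) ∈ Subgroup.centralizer {y}
      rw [mem_centralizer_singleton]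
      conv_rhs => rw [← h1]
      simp [mul_assoc]
    · intro a
      obtain ⟨n, hn⟩ := (hP.to_subgroup ⊤).exists_engel_eq_one (P := ⊤) (a := (a : P)) (x := y)
        trivial trivial
      refine ⟨n, ?_⟩
      have h1 : ∀ i, (((fun b : A => b⁻¹ * σ b)^[i] a : A) : P) = engel (a : P) y i := by
        intro i
        induction i with
        | zero => rfl
        | succ i ih =>
          rw [Function.iterate_succ_apply', engel, ← ih, Subgroup.coe_mul, hσ]
          simp [cmtr, mul_assoc]
      ext
      rw [h1, hn]
      rfl
  have hidx : A.index ≤ (Nat.card A)! := by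
    have hker : (MulAut.conjNormal : P →* MulAut A).ker ≤ A := by
      refine le_trans (fun x hx => ?_) hC
      rw [Subgroup.mem_centralizer_iff]
      intro a ha
      have h1 : (MulAut.conjNormal x : MulAut A) ⟨a, ha⟩ = ⟨a, ha⟩ := by
        rw [MonoidHom.mem_ker.1 hx]; rfl
      have h2 := congrArg Subtype.val h1
      rw [MulAut.conjNormal_apply] at h2
      have h3 : x * a * x⁻¹ * x = a * x := by rw [h2]
      simpa using h3.symm
    have h1 : A.index ≤ (MulAut.conjNormal : P →* MulAut A).ker.index :=
      Nat.le_of_dvd (Nat.pos_of_ne_zero Subgroup.index_ne_zero_of_finite)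
        (Subgroup.index_dvd_of_le hker)
    refine h1.trans ?_
    rw [Subgroup.index_ker, ← Nat.card_perm]
    refine Nat.card_le_card_of_injective (fun f => f.1.toEquiv) ?_
    intro f g hfg
    exact Subtype.ext (MulEquiv.toEquiv_injective hfg)
  rw [← A.card_mul_index]
  exact Nat.mul_le_mul hcardA (hidx.trans (Nat.factorial_le hcardA))

end GroupLemmas

section LocalCores

variable {G : Type u} [Group G] [Finite G]

theorem exists_engel_ne_one_of_pcore_eq_bot {p : ℕ} [Fact p.Prime] (hG : pcore p G = ⊥) {y : G}
    (hy : ∃ k, y ^ p ^ k = 1) (hy1 : y ≠ 1) :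
    ∃ x : G, (∃ k, x ^ p ^ k = 1) ∧ ∀ n, engel y x n ≠ 1 := by
  by_contra! hcon
  have hD : ∀ g : G, ∀ w ∈ {w | ∃ c : G, w = c * y * c⁻¹}, g * w * g⁻¹ ∈
      {w | ∃ c : G, w = c * y * c⁻¹} := by
    rintro g w ⟨c, rfl⟩
    exact ⟨g * c, by group⟩
  have hDp : ∀ w ∈ {w | ∃ c : G, w = c * y * c⁻¹}, ∃ k, w ^ p ^ k = 1 := by
    rintro w ⟨c, rfl⟩
    obtain ⟨k, hk⟩ := hy
    exact ⟨k, by rw [conj_pow, hk]; group⟩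
  have := mem_pcore_of_engel hD hDp ?_ (y := y) ⟨1, by simp⟩
  · rw [hG] at this
    exact hy1 this
  · rintro x hx w ⟨c, rfl⟩
    obtain ⟨n, hn⟩ := hcon (c⁻¹ * x * c) (by
      obtain ⟨k, hk⟩ := hDp x hx
      refine ⟨k, ?_⟩
      have : c⁻¹ * x * c = c⁻¹ * x * c⁻¹⁻¹ := by group
      rw [this, conj_pow, hk]; group)
    refine ⟨n, ?_⟩
    have := conj_engel c y (c⁻¹ * x * c) n
    rw [hn] at this
    simpa [mul_assoc] using this.symm

theorem exists_nilpotent_of_pcore_eq_bot {p : ℕ} [Fact p.Prime] {m h : ℕ}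
    (hG : HasSinks (m + 1) G) (hT : IndexBound.{u} m h) (hp : pcore p G = ⊥) {y : G}
    (hy : ∃ k, y ^ p ^ k = 1) (hy1 : y ≠ 1) :
    ∃ (x : G) (U : Subgroup G) (c : ℕ), (∃ k, x ^ p ^ k = 1) ∧ (∀ n, engel y x n ≠ 1) ∧
      x ∈ Subgroup.normalizer (U : Set G) ∧ (∀ z ∈ U, ∀ w ∈ U, engel z w c = 1) ∧
      U.relIndex (Subgroup.centralizer {y}) ≤ h * (m + 1) ^ (m + 1) := by
  obtain ⟨x, hx, hq⟩ := exists_engel_ne_one_of_pcore_eq_bot hp hy hy1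
  obtain ⟨U, c, h1, h2, h3⟩ := exists_nilpotent_of_engel_ne_one hG hT hq
  exact ⟨x, U, c, hx, hq, h1, h2, h3⟩

theorem orderOf_le_of_pcore_eq_bot {p : ℕ} [hp' : Fact p.Prime] {m h : ℕ}
    (hG : HasSinks (m + 1) G) (hT : IndexBound.{u} m h) (hp : pcore p G = ⊥) (hh : 0 < h) {g : G}
    (hg : ∃ k, g ^ p ^ k = 1) : orderOf g ≤ h * (m + 1) ^ (m + 1) := by
  by_contra! hlt
  set j := h * (m + 1) ^ (m + 1) with hj
  have hj0 : 0 < j := by positivity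
  obtain ⟨k, hk⟩ := hg
  obtain ⟨k, -, hk⟩ := (Nat.dvd_prime_pow hp'.out).1 (orderOf_dvd_of_pow_eq_one hk)
  obtain ⟨k, rfl⟩ : ∃ l, k = l + 1 := Nat.exists_eq_succ_of_ne_zero (by
    rintro rfl
    rw [hk, pow_zero] at hlt; omega)
  set y := g ^ p ^ k with hy
  have hyp : y ^ p = 1 := by rw [hy, ← pow_mul, ← pow_succ, ← hk, pow_orderOf_eq_one]
  have hy1 : y ≠ 1 := fun h => by
    have := orderOf_dvd_of_pow_eq_one h
    rw [hk, Nat.pow_dvd_pow_iff_le_right hp'.out.one_lt] at this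
    omega
  obtain ⟨x, U, c, ⟨l, hx⟩, hq, hxU, hU, hrel⟩ :=
    exists_nilpotent_of_pcore_eq_bot hG hT hp ⟨1, by rwa [pow_one]⟩ hy1
  have hgC : g ∈ Subgroup.centralizer {y} := by
    rw [mem_centralizer_singleton]; exact (Commute.refl g).pow_right _
  obtain ⟨i, hi0, hij, hiU⟩ := Subgroup.exists_pow_mem_of_relIndex_ne_zero
    (Subgroup.relIndex_ne_zero_of_finite U (Subgroup.centralizer {y})) hgC
  have hyU : y ∈ U := by
    obtain ⟨a, b, hb, rfl⟩ := Nat.exists_eq_pow_mul_and_not_dvd hi0.ne' p hp'.out.ne_one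
    have hcop : b.Coprime (orderOf (g ^ p ^ a)) := by
      refine Nat.Coprime.coprime_dvd_right (orderOf_pow_dvd _) ?_
      rw [hk]
      exact (Nat.Coprime.pow_left _ ((Nat.Prime.coprime_iff_not_dvd hp'.out).2 hb)).symm
    obtain ⟨s, hs⟩ := exists_pow_eq_self_of_coprime hcop
    have hga : g ^ p ^ a ∈ U := by
      rw [← hs, ← pow_mul g]
      exact U.pow_mem hiU.1 s
    have hak : a ≤ k := by
      have h1 : p ^ a < p ^ (k + 1) := by
        rw [← hk]
        refine lt_of_le_of_lt ?_ hlt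
        refine le_trans ?_ (hij.trans hrel)
        exact Nat.le_mul_of_pos_right _ (Nat.pos_of_ne_zero (by rintro rfl; simp at hb))
      have := (Nat.pow_lt_pow_iff_right hp'.out.one_lt).1 h1
      omega
    have : y = (g ^ p ^ a) ^ p ^ (k - a) := by
      rw [← pow_mul, ← pow_add, Nat.add_sub_cancel' hak]
    rw [this]
    exact U.pow_mem hga _
  set M := Subgroup.normalizer (U : Set G) with hM
  have hUM : U ≤ M := Subgroup.le_normalizer
  have hyM := mem_pcore_of_mem_nilpotent (p := p) (N := U.subgroupOf M) (e := ⟨y, hUM hyU⟩)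
    (by
      rintro ⟨z, hz⟩ hzU ⟨w, hw⟩ hwU
      refine ⟨c, Subtype.ext ?_⟩
      have := map_engel M.subtype ⟨z, hz⟩ ⟨w, hw⟩ c
      exact this.trans (hU z hzU w hwU)) hyU ⟨1, by rw [pow_one]; exact Subtype.ext hyp⟩
  obtain ⟨P, hP⟩ := exists_mem_sylow (p := p) (g := (⟨x, hxU⟩ : M)) ⟨l, Subtype.ext hx⟩
  obtain ⟨n, hn⟩ := P.2.exists_engel_eq_one (mem_pcore.1 hyM P) hP
  apply hq n
  exact (map_engel M.subtype ⟨y, hUM hyU⟩ ⟨x, hxU⟩ n).symm.trans (congrArg Subtype.val hn)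

/-- Every centralizer of a nontrivial element has a normal `p`-subgroup of index at most `j` in
every `p`-subgroup. -/
def HasLocalCores (p j : ℕ) (G : Type*) [Group G] : Prop :=
  ∀ z : G, z ≠ 1 → ∃ O : Subgroup G, IsPGroup p O ∧
    Subgroup.centralizer {z} ≤ Subgroup.normalizer (O : Set G) ∧
    ∀ Q : Subgroup G, IsPGroup p Q → Q ≤ Subgroup.centralizer {z} → O.relIndex Q ≤ j

theorem exists_prime_pow_mem_zpowers {G : Type*} [Group G] [Finite G] {z : G} (hz : z ≠ 1) :
    ∃ q, q.Prime ∧ ∃ i : ℕ, z ^ i ≠ 1 ∧ (z ^ i) ^ q = 1 := by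
  have h1 : orderOf z ≠ 1 := fun h => hz (orderOf_eq_one_iff.1 h)
  obtain ⟨q, hq, d, hd⟩ := Nat.exists_prime_and_dvd h1
  refine ⟨q, hq, d, ?_, ?_⟩
  · intro h
    have h2 := Nat.le_of_dvd (Nat.pos_of_ne_zero (by
      rintro rfl; exact (orderOf_pos z).ne' (by simpa using hd))) (orderOf_dvd_of_pow_eq_one h)
    have h3 := hq.two_le
    have h4 := orderOf_pos z
    nlinarith
  · rw [← pow_mul, mul_comm, ← hd, pow_orderOf_eq_one]

theorem hasLocalCores_of_pcore_eq_bot {m h : ℕ} (hG : HasSinks (m + 1) G)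
    (hT : IndexBound.{u} m h) (hp : ∀ q, q.Prime → pcore q G = ⊥) (p : ℕ) [Fact p.Prime] :
    HasLocalCores p (h * (m + 1) ^ (m + 1))! G := by
  intro z hz
  obtain ⟨q, hq, i, hi1, hiq⟩ := exists_prime_pow_mem_zpowers hz
  have : Fact q.Prime := ⟨hq⟩
  obtain ⟨x, U, c, -, -, -, hU, hrel⟩ :=
    exists_nilpotent_of_pcore_eq_bot hG hT (hp q hq) ⟨1, by rwa [pow_one]⟩ hi1
  set C := Subgroup.centralizer {z} with hC
  have hCle : C ≤ Subgroup.centralizer {z ^ i} := by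
    intro a ha
    rw [mem_centralizer_singleton] at ha ⊢
    exact (show Commute a z from ha).pow_right i
  obtain ⟨N, hNU, hNC, hnorm, hNrel⟩ := Subgroup.exists_core U C
  have hj : N.relIndex C ≤ (h * (m + 1) ^ (m + 1))! :=
    hNrel.trans (Nat.factorial_le ((Subgroup.relIndex_mono_right U hCle).trans hrel))
  refine ⟨(pcore p C).map C.subtype, (isPGroup_pcore p).map _, ?_, ?_⟩
  · have h1 : Subgroup.normalizer (pcore p C : Set C) = ⊤ :=
      Subgroup.normalizer_eq_top_iff.2 (pcore_normal p)
    have h2 := Subgroup.le_normalizer_map (H := pcore p C) C.subtype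
    rw [h1, ← MonoidHom.range_eq_map, Subgroup.range_subtype] at h2
    exact h2
  · intro Q hQ hQC
    refine le_trans ?_ ((Subgroup.relIndex_mono_right N hQC).trans hj)
    rw [← Subgroup.inf_relIndex_right N Q]
    refine Subgroup.relIndex_anti_left ?_ Q
    rintro a ⟨haN, haQ⟩
    have : (N.subgroupOf C).Normal := Subgroup.normal_subgroupOf_of_le_normalizer hnorm
    refine ⟨⟨a, hQC haQ⟩, ?_, rfl⟩
    refine mem_pcore_of_mem_nilpotent (N := N.subgroupOf C) ?_ haN ?_
    · rintro ⟨s, hs⟩ hsN ⟨t, ht⟩ htN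
      refine ⟨c, Subtype.ext ?_⟩
      exact (map_engel C.subtype ⟨s, hs⟩ ⟨t, ht⟩ c).trans (hU s (hNU hsN) t (hNU htN))
    · obtain ⟨k, hk⟩ := IsPGroup.exists_pow_eq_one hQ haQ
      exact ⟨k, Subtype.ext hk⟩

end LocalCores

open scoped Pointwise

section SylowInvariant

variable {G : Type*} [Group G]

/-- The elements centralizing a subgroup of index at most `r` of `P`. -/
def nearSet (r : ℕ) (P : Subgroup G) : Set G := {μ | (Subgroup.centralizer {μ}).relIndex P ≤ r}

/-- The largest subgroup of `P` normalized by `S`. -/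
def invCore (P : Subgroup G) (S : Set G) : Subgroup G where
  carrier := {x | ∀ h ∈ Subgroup.closure S, h * x * h⁻¹ ∈ P}
  mul_mem' := by
    intro a b ha hb h hh
    have := P.mul_mem (ha h hh) (hb h hh)
    simpa [mul_assoc] using this
  one_mem' := by intro h _; simp
  inv_mem' := by
    intro a ha h hh
    have := P.inv_mem (ha h hh)
    simpa [mul_assoc] using this

theorem invCore_le (P : Subgroup G) (S : Set G) : invCore P S ≤ P := fun x hx => by
  simpa using hx 1 (one_mem _)

theorem le_invCore {P N : Subgroup G} {S : Set G} (hN : N ≤ P)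
    (hS : S ⊆ Subgroup.normalizer (N : Set G)) : N ≤ invCore P S := by
  intro x hx h hh
  have h1 : Subgroup.closure S ≤ Subgroup.normalizer (N : Set G) := (Subgroup.closure_le _).2 hS
  exact hN ((Subgroup.mem_normalizer_iff.1 (h1 hh) x).1 hx)

theorem invCore_anti (P : Subgroup G) {S T : Set G} (h : S ⊆ T) : invCore P T ≤ invCore P S :=
  fun _ hx g hg => hx g (Subgroup.closure_mono h hg)

theorem subset_normalizer_invCore [Finite G] (P : Subgroup G) (S : Set G) :
    S ⊆ Subgroup.normalizer (invCore P S : Set G) := by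
  intro s hs
  refine Subgroup.mem_normalizer_of_conj_mem fun y hy h hh => ?_
  have := hy (h * s) (mul_mem hh (Subgroup.subset_closure hs))
  simpa [mul_assoc] using this

theorem smul_nearSet (a : MulAut G) (r : ℕ) (P : Subgroup G) :
    nearSet r (a • P) = a • nearSet r P := by
  ext μ
  rw [Set.mem_smul_set_iff_inv_smul_mem]
  have : Subgroup.centralizer {μ} = a • Subgroup.centralizer {a⁻¹ • μ} := by
    ext x
    rw [Subgroup.mem_pointwise_smul_iff_inv_smul_mem, mem_centralizer_singleton,
      mem_centralizer_singleton, ← smul_mul', ← smul_mul']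
    exact (MulAction.injective a⁻¹).eq_iff.symm
  change (Subgroup.centralizer {μ}).relIndex (a • P) ≤ r ↔ _
  rw [this, Subgroup.relIndex_pointwise_smul]
  rfl

theorem smul_invCore (a : MulAut G) (P : Subgroup G) (S : Set G) :
    invCore (a • P) (a • S) = a • invCore P S := by
  have key : ∀ (a : MulAut G) (P : Subgroup G) (S : Set G),
      a • invCore P S ≤ invCore (a • P) (a • S) := by
    intro a P S x hx h hh
    rw [Subgroup.mem_pointwise_smul_iff_inv_smul_mem] at hx ⊢
    rw [← Subgroup.smul_closure, Subgroup.mem_pointwise_smul_iff_inv_smul_mem] at hh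
    have := hx _ hh
    rwa [← smul_inv', ← smul_mul', ← smul_mul'] at this
  refine le_antisymm ?_ (key a P S)
  have := key a⁻¹ (a • P) (a • S)
  rwa [inv_smul_smul, inv_smul_smul, ← Subgroup.subset_pointwise_smul_iff] at this

/-- The largest subgroup of `P` normalized by `P` and by all elements centralizing a subgroup of
index at most `r` of `P`. -/
def nearCore (r : ℕ) (P : Subgroup G) : Subgroup G := invCore P (nearSet r P ∪ P)

theorem smul_nearCore (a : MulAut G) (r : ℕ) (P : Subgroup G) :
    nearCore r (a • P) = a • nearCore r P := by
  unfold nearCore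
  rw [smul_nearSet, ← smul_invCore, Set.smul_set_union, Subgroup.coe_pointwise_smul]

/-- A conjugation-equivariant assignment of subgroups to Sylow subgroups such that `I P` is
normalized by `P` and by all elements centralizing a large subgroup of `P`. -/
structure IsSylowInvariant {p : ℕ} (r : ℕ) (I : Sylow p G → Subgroup G) : Prop where
  mem_normalizer_iff : ∀ P g, g ∈ Subgroup.normalizer (I P : Set G) ↔ I (g • P) = I P
  le_normalizer : ∀ P : Sylow p G, (P : Subgroup G) ≤ Subgroup.normalizer (I P : Set G)
  near : ∀ (P : Sylow p G) (μ : G), (Subgroup.centralizer {μ}).relIndex P ≤ r →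
    μ ∈ Subgroup.normalizer (I P : Set G)

theorem mem_normalizer_iff_conj_smul [Finite G] {H : Subgroup G} {g : G} :
    g ∈ Subgroup.normalizer (H : Set G) ↔ MulAut.conj g • H = H := by
  constructor
  · intro hg
    ext x
    rw [Subgroup.mem_pointwise_smul_iff_inv_smul_mem, ← map_inv, MulAut.smul_def,
      MulAut.conj_apply]
    exact (Subgroup.mem_normalizer_iff.1 (inv_mem hg) x).symm
  · intro h
    refine Subgroup.mem_normalizer_of_conj_mem fun y hy => ?_
    rw [← h]
    exact Subgroup.smul_mem_pointwise_smul y (MulAut.conj g) H hy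

theorem isSylowInvariant_nearCore [Finite G] (p r : ℕ) :
    IsSylowInvariant r fun P : Sylow p G => nearCore r P where
  mem_normalizer_iff P g := by
    rw [mem_normalizer_iff_conj_smul, ← smul_nearCore, Sylow.coe_subgroup_smul]
  le_normalizer P := fun _ hx => subset_normalizer_invCore _ _ (Or.inr hx)
  near P _ h := subset_normalizer_invCore _ _ (Or.inl h)

theorem IsSylowInvariant.exists_le [Finite G] {p : ℕ} [Fact p.Prime] {r : ℕ}
    {I : Sylow p G → Subgroup G} (hI : IsSylowInvariant r I) (P : Sylow p G) {Q : Subgroup G}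
    (hQ : IsPGroup p Q) (h : Q ≤ Subgroup.normalizer (I P : Set G)) :
    ∃ P' : Sylow p G, Q ≤ P' ∧ I P' = I P := by
  set K := Subgroup.normalizer (I P : Set G) with hK
  obtain ⟨S, hS⟩ := (hQ.comap_subtype (K := K)).exists_le_sylow
  obtain ⟨k, rfl⟩ := MulAction.exists_smul_eq K (P.subtype (hI.le_normalizer P)) S
  refine ⟨(k : G) • P, fun x hx => ?_, (hI.mem_normalizer_iff P k).1 k.2⟩
  have h1 : (⟨x, h hx⟩ : K) ∈ k • P.subtype (hI.le_normalizer P) := hS hx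
  rw [Sylow.mem_smul_iff] at h1
  change x ∈ (k : G) • P
  rw [Sylow.mem_smul_iff]
  exact h1

theorem relIndex_biInf_le {r : ℕ} (L : Subgroup G) (F : Finset G)
    (hF : ∀ μ ∈ F, (Subgroup.centralizer {μ}).relIndex L ≤ r) :
    (⨅ μ ∈ F, Subgroup.centralizer {μ}).relIndex L ≤ r ^ F.card := by
  classical
  induction F using Finset.induction_on with
  | empty => simp
  | insert a F ha ih =>
    rw [Finset.iInf_insert, Finset.card_insert_of_notMem ha, pow_succ']
    exact Subgroup.relIndex_inf_le.trans (Nat.mul_le_mul (hF a (Finset.mem_insert_self _ _))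
      (ih fun μ hμ => hF μ (Finset.mem_insert_of_mem hμ)))

theorem relIndex_invCore_le [Finite G] {p : ℕ} [Fact p.Prime] {j r : ℕ} (hr : 0 < r)
    (hL : HasLocalCores p j G) (P : Sylow p G) (hP : (r ^ j)! < Nat.card P) {F : Finset G}
    (hF : (F : Set G) ⊆ nearSet r P) (hFj : F.card ≤ j) :
    (invCore P (F ∪ P : Set G)).relIndex P ≤ j := by
  have h1 : (⨅ μ ∈ F, Subgroup.centralizer {μ}).relIndex P ≤ r ^ j :=
    (relIndex_biInf_le (P : Subgroup G) F fun μ hμ => hF hμ).trans (Nat.pow_le_pow_right hr hFj)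
  obtain ⟨e, heF, heP, he1, hec⟩ := P.2.exists_central h1 hP
  obtain ⟨O, hO, hOn, hOrel⟩ := hL e he1
  have hPC : (P : Subgroup G) ≤ Subgroup.centralizer {e} := fun x hx => by
    rw [mem_centralizer_singleton]; exact (hec x hx).symm
  have hOP : O ≤ P := by
    have h2 := hO.to_sup_of_normal_left' P.2 (hPC.trans hOn)
    rw [← P.3 h2 le_sup_right]
    exact le_sup_left
  refine (Subgroup.relIndex_anti_left (le_invCore hOP ?_) _).trans (hOrel P P.2 hPC)
  rintro x (hx | hx)
  · refine hOn ?_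
    rw [mem_centralizer_singleton]
    simp only [Subgroup.mem_iInf] at heF
    exact (mem_centralizer_singleton.1 (heF x hx)).symm
  · exact hOn (hPC hx)

theorem relIndex_nearCore_le [Finite G] {p : ℕ} [Fact p.Prime] {j r : ℕ} (hr : 0 < r)
    (hL : HasLocalCores p j G) (P : Sylow p G) (hP : (r ^ j)! < Nat.card P) :
    (nearCore r (P : Subgroup G)).relIndex P ≤ j := by
  classical
  by_contra! hlt
  have key : ∀ k ≤ j, ∃ F : Finset G, (F : Set G) ⊆ nearSet r P ∧ F.card ≤ k ∧
      k + 1 ≤ (invCore P (F ∪ P : Set G)).relIndex P := by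
    intro k
    induction k with
    | zero =>
      intro _
      exact ⟨∅, by simp, by simp,
        Nat.pos_of_ne_zero (Subgroup.relIndex_ne_zero_of_finite _ _)⟩
    | succ k ih =>
      intro hk
      obtain ⟨F, hF, hFk, hrel⟩ := ih (by omega)
      have hFj := relIndex_invCore_le hr hL P hP hF (by omega)
      obtain ⟨μ, hμ, hμn⟩ : ∃ μ ∈ nearSet r (P : Subgroup G),
          μ ∉ Subgroup.normalizer (invCore P (F ∪ P : Set G) : Set G) := by
        by_contra! hcon
        have h1 : invCore P (F ∪ P : Set G) ≤ nearCore r (P : Subgroup G) := by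
          refine le_invCore (invCore_le _ _) ?_
          rintro x (hx | hx)
          · exact hcon x hx
          · exact subset_normalizer_invCore _ _ (Or.inr hx)
        have h2 := Subgroup.relIndex_anti_left h1 (P : Subgroup G)
        omega
      have hsub : (F ∪ P : Set G) ⊆ ((insert μ F : Finset G) ∪ P : Set G) := by
        rw [Finset.coe_insert]
        exact Set.union_subset_union_left _ (Set.subset_insert _ _)
      refine ⟨insert μ F, ?_, (Finset.card_insert_le _ _).trans (by omega), ?_⟩
      · rw [Finset.coe_insert]
        exact Set.insert_subset hμ hF
      · have hle := invCore_anti (P : Subgroup G) hsub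
        have hne : invCore P ((insert μ F : Finset G) ∪ P : Set G) ≠ invCore P (F ∪ P : Set G) := by
          intro he
          apply hμn
          rw [← he]
          exact subset_normalizer_invCore _ _ (Or.inl (Finset.mem_coe.2 (Finset.mem_insert_self _ _)))
        have h3 := Subgroup.relIndex_mul_relIndex _ _ (P : Subgroup G) hle (invCore_le _ _)
        have h4 : (invCore P ((insert μ F : Finset G) ∪ P : Set G)).relIndex
            (invCore P (F ∪ P : Set G)) ≠ 1 := by
          rw [Ne, Subgroup.relIndex_eq_one]
          exact fun h => hne (le_antisymm hle h)
        have h5 := Subgroup.relIndex_ne_zero_of_finite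
          (invCore P ((insert μ F : Finset G) ∪ P : Set G)) (invCore P (F ∪ P : Set G))
        rw [← h3]
        have : 2 ≤ (invCore P ((insert μ F : Finset G) ∪ P : Set G)).relIndex
            (invCore P (F ∪ P : Set G)) := by omega
        nlinarith
  obtain ⟨F, hF, hFk, hrel⟩ := key j le_rfl
  have := relIndex_invCore_le hr hL P hP hF hFk
  omega

theorem nearCore_ne_bot [Finite G] {p : ℕ} [Fact p.Prime] {j r : ℕ} (hr : 0 < r)
    (hL : HasLocalCores p j G) (P : Sylow p G) (hP : (r ^ j)! < Nat.card P)
    (hPj : j < Nat.card P) : nearCore r (P : Subgroup G) ≠ ⊥ := by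
  intro h
  have := relIndex_nearCore_le hr hL P hP
  rw [h, Subgroup.relIndex_bot_left] at this
  exact absurd hPj (not_lt.2 this)

end SylowInvariant

section SylowIntersections

theorem Subgroup.eq_top_of_forall_sylow_le {A : Type*} [Group A] [Finite A] {K : Subgroup A}
    (h : ∀ q, q.Prime → ∃ S : Sylow q A, (S : Subgroup A) ≤ K) : K = ⊤ := by
  rw [← Subgroup.index_eq_one]
  by_contra hne
  obtain ⟨q, hq, hd⟩ := Nat.exists_prime_and_dvd hne
  obtain ⟨S, hS⟩ := h q hq
  have : Fact q.Prime := ⟨hq⟩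
  exact S.not_dvd_index (hd.trans (Subgroup.index_dvd_of_le hS))

theorem Subgroup.card_lt_mul_of_relIndex_le {G : Type*} [Group G] {O Q : Subgroup G} {j u : ℕ} (h : O.relIndex Q ≤ j)
    (hu : u * j < Nat.card Q) : u < Nat.card (O ⊓ Q : Subgroup G) := by
  have h1 := Subgroup.relIndex_mul_relIndex ⊥ (O ⊓ Q) Q bot_le inf_le_right
  rw [Subgroup.relIndex_bot_left, Subgroup.relIndex_bot_left, Subgroup.inf_relIndex_right] at h1
  by_contra! hle
  have := Nat.mul_le_mul hle h
  omega

variable {G : Type*} [Group G] [Finite G] {p : ℕ} [hp : Fact p.Prime]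

theorem IsPGroup.lt_inf_normalizer {P D : Subgroup G} (hP : IsPGroup p P) (hD : D < P) :
    D < P ⊓ Subgroup.normalizer (D : Set G) := by
  have : Group.IsNilpotent P := hP.isNilpotent
  have hlt : D.subgroupOf P < ⊤ := by
    rw [lt_top_iff_ne_top, Ne, Subgroup.subgroupOf_eq_top]
    exact not_le_of_gt hD
  have h1 := Group.normalizerCondition_of_isNilpotent (D.subgroupOf P) hlt
  obtain ⟨⟨x, hxP⟩, hxn, hxD⟩ := SetLike.exists_of_lt h1
  refine lt_of_le_of_ne (le_inf hD.le Subgroup.le_normalizer) fun he => hxD ?_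
  rw [Subgroup.mem_subgroupOf]
  rw [he]
  refine ⟨hxP, Subgroup.mem_normalizer_of_conj_mem fun y hy => ?_⟩
  exact (Subgroup.mem_normalizer_iff.1 hxn ⟨y, hD.le hy⟩).1 hy

/-- Let `D` be a large `p`-subgroup contained in a Sylow subgroup `P` such that `I` is constant on
Sylow subgroups having intersection larger than `D`. Then `p'`-elements normalizing `D` normalize
`I P`. -/
theorem IsSylowInvariant.mem_normalizer_of_coprime {M j₀ j r : ℕ} {I : Sylow p G → Subgroup G}
    (hI : IsSylowInvariant r I) (hG : HasSinks M G) (hL : HasLocalCores p j G) (hpj : p ≤ j₀)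
    (hj : 0 < j) (hr : M * j₀ ^ j ≤ r) {D : Subgroup G} {P : Sylow p G} (hD : D ≤ P)
    (hDr : r ! < Nat.card D)
    (hmax : ∀ P₁ P₂ : Sylow p G, Nat.card D < Nat.card (P₁ ⊓ P₂ : Subgroup G) → I P₁ = I P₂)
    {μ : G} (hμ : p.Coprime (orderOf μ)) (hμD : μ ∈ Subgroup.normalizer (D : Set G)) :
    μ ∈ Subgroup.normalizer (I P : Set G) := by
  have hp2 := hp.out.two_le
  have hDp : IsPGroup p D := P.2.to_le hD
  have hCD := IsPGroup.relIndex_centralizer_le hG hDp hμ hμD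
  have hCQ : ∀ Q : Subgroup G, D.relIndex Q ≤ p ^ j → (Subgroup.centralizer {μ}).relIndex Q ≤ r := by
    intro Q hQ
    refine (Subgroup.relIndex_le_mul _ D Q).trans (le_trans ?_ hr)
    exact Nat.mul_le_mul hCD (hQ.trans (Nat.pow_le_pow_left hpj j))
  have hcard : ∀ Q : Subgroup G, D ≤ Q → D.relIndex Q * Nat.card D = Nat.card Q := by
    intro Q hQ
    have := Subgroup.relIndex_mul_relIndex ⊥ D Q bot_le hQ
    rwa [Subgroup.relIndex_bot_left, Subgroup.relIndex_bot_left, mul_comm] at this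
  obtain ⟨a, ha⟩ := hDp.exists_card_eq
  obtain ⟨b, hb⟩ := P.2.exists_card_eq
  by_cases hab : b ≤ a + j
  · refine hI.near P μ (hCQ P ?_)
    have h1 := hcard P hD
    rw [ha, hb] at h1
    have h2 : p ^ b ≤ p ^ (a + j) := Nat.pow_le_pow_right (by omega) hab
    rw [← h1, pow_add, mul_comm] at h2
    exact Nat.le_of_mul_le_mul_left h2 (by positivity)
  push Not at hab
  have hDP : Nat.card (D.subgroupOf P) = p ^ a := by
    rw [← ha, Nat.card_congr (Subgroup.subgroupOfEquivOfLe hD).toEquiv]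
  obtain ⟨K, hK, hDK⟩ := Sylow.exists_subgroup_card_pow_prime_le p (n := a) (m := a + j)
    (G := P) (by
      have : Nat.card P = p ^ b := hb
      rw [this]; exact pow_dvd_pow p hab.le) _ hDP (by omega)
  obtain ⟨Q, rfl⟩ : ∃ Q : Subgroup G, Q = K.map (P : Subgroup G).subtype := ⟨_, rfl⟩
  set Q := K.map (P : Subgroup G).subtype with hQ
  have hQP : Q ≤ P := Subgroup.map_subtype_le K
  have hDQ : D ≤ Q := fun x hx => ⟨⟨x, hD hx⟩, hDK hx, rfl⟩
  have hQc : Nat.card Q = p ^ (a + j) := by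
    rw [← hK]
    exact Nat.card_congr (K.equivMapOfInjective _ (Subgroup.subtype_injective _)).symm.toEquiv
  have hQp : IsPGroup p Q := P.2.to_le hQP
  have hrel : D.relIndex Q ≤ p ^ j := by
    have h1 := hcard Q hDQ
    rw [ha, hQc, pow_add, mul_comm] at h1
    exact (Nat.eq_of_mul_eq_mul_left (by positivity) h1).le
  obtain ⟨e, heC, heQ, he1, hec⟩ := hQp.exists_central (hCQ Q hrel)
    (hDr.trans_le (Subgroup.card_le_of_le hDQ))
  obtain ⟨O, hO, hOn, hOrel⟩ := hL e he1
  have hQC : Q ≤ Subgroup.centralizer {e} := fun x hx => by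
    rw [mem_centralizer_singleton]; exact (hec x hx).symm
  have hμC : μ ∈ Subgroup.centralizer {e} := by
    rw [mem_centralizer_singleton] at heC ⊢; exact heC.symm
  obtain ⟨P₁, hP₁⟩ := (hO.to_sup_of_normal_left' hQp (hQC.trans hOn)).exists_le_sylow
  have hjp : j < p ^ j := Nat.lt_pow_self hp.out.one_lt
  have hD0 : 0 < Nat.card D := Nat.card_pos
  have hDltQ : Nat.card D < Nat.card Q := by
    rw [hQc, pow_add, ha]
    have : 0 < p ^ a := by positivity
    nlinarith
  have h1 : I P₁ = I P := by
    refine hmax P₁ P (hDltQ.trans_le (Subgroup.card_le_of_le (le_inf ?_ hQP)))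
    exact le_sup_right.trans hP₁
  have hDltO : Nat.card D < Nat.card (O ⊓ Q : Subgroup G) := by
    refine Subgroup.card_lt_mul_of_relIndex_le (hOrel Q hQp hQC) ?_
    rw [hQc, pow_add, ha]
    exact Nat.mul_lt_mul_of_pos_left hjp (by positivity)
  have hOP : O ≤ P₁ := le_sup_left.trans hP₁
  have h2 : I (μ • P₁) = I P₁ := by
    refine hmax _ _ (hDltO.trans_le (Subgroup.card_le_of_le (inf_le_left.trans (le_inf ?_ hOP))))
    intro x hx
    change x ∈ μ • P₁
    rw [Sylow.mem_smul_iff]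
    exact hOP ((Subgroup.mem_normalizer_iff''.1 (hOn hμC) x).1 hx)
  rw [← h1]
  exact (hI.mem_normalizer_iff P₁ μ).2 h2

theorem IsSylowInvariant.eq_of_lt_card_inf {M j₀ j r : ℕ} {I : Sylow p G → Subgroup G}
    (hI : IsSylowInvariant r I) (hG : HasSinks M G) (hL : HasLocalCores p j G) (hpj : p ≤ j₀)
    (hj : 0 < j) (hr : M * j₀ ^ j ≤ r) (P P' : Sylow p G)
    (hu : r ! < Nat.card (P ⊓ P' : Subgroup G)) : I P = I P' := by
  obtain ⟨n, hn⟩ : ∃ n, n = Nat.card G - Nat.card ((P : Subgroup G) ⊓ P' : Subgroup G) := ⟨_, rfl⟩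
  induction n using Nat.strong_induction_on generalizing P P' with
  | _ n ih =>
  obtain ⟨D, hD⟩ : ∃ D : Subgroup G, D = (P : Subgroup G) ⊓ P' := ⟨_, rfl⟩
  rw [← hD] at hn hu
  have hmax : ∀ P₁ P₂ : Sylow p G, Nat.card D < Nat.card (P₁ ⊓ P₂ : Subgroup G) →
      I P₁ = I P₂ := by
    intro P₁ P₂ hlt
    refine ih _ ?_ P₁ P₂ (hu.trans hlt) rfl
    have := Subgroup.card_le_card_group (P₁ ⊓ P₂ : Subgroup G)
    omega
  have hcl : ∀ {A B : Subgroup G}, A < B → Nat.card A < Nat.card B := by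
    intro A B hAB
    refine lt_of_le_of_ne (Subgroup.card_le_of_le hAB.le) fun he => hAB.ne ?_
    exact Subgroup.eq_of_le_of_card_ge hAB.le he.ge
  by_cases hDP : D = P
  · have : (P : Subgroup G) ≤ P' := by rw [← hDP, hD]; exact inf_le_right
    rw [Sylow.ext (P.3 P'.2 this).symm]
  by_cases hDP' : D = P'
  · have : (P' : Subgroup G) ≤ P := by rw [← hDP', hD]; exact inf_le_left
    rw [Sylow.ext (P'.3 P.2 this).symm]
  have hlt : D < P := lt_of_le_of_ne (hD ▸ inf_le_left) hDP
  have hlt' : D < P' := lt_of_le_of_ne (hD ▸ inf_le_right) hDP'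
  have h1 := P.2.lt_inf_normalizer hlt
  have h2 := P'.2.lt_inf_normalizer hlt'
  set N := Subgroup.normalizer (D : Set G) with hN
  obtain ⟨S, hS⟩ := (P.2.comap_subtype (K := N)).exists_le_sylow
  obtain ⟨Q, hQ⟩ := (S.2.map N.subtype).exists_le_sylow
  have hPQ : (P : Subgroup G) ⊓ N ≤ Q := by
    rintro x ⟨hx, hxN⟩
    exact hQ ⟨⟨x, hxN⟩, hS hx, rfl⟩
  have hQP : I Q = I P := by
    refine hmax Q P ((hcl h1).trans_le (Subgroup.card_le_of_le (le_inf hPQ inf_le_left)))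
  have hNK : N ≤ Subgroup.normalizer (I Q : Set G) := by
    rw [← Subgroup.subgroupOf_eq_top]
    refine Subgroup.eq_top_of_forall_sylow_le fun q hq => ?_
    by_cases hqp : q = p
    · subst hqp
      refine ⟨S, fun x hx => ?_⟩
      exact hI.le_normalizer Q (hQ ⟨x, hx, rfl⟩)
    · have : Fact q.Prime := ⟨hq⟩
      obtain ⟨T⟩ : Nonempty (Sylow q N) := inferInstance
      refine ⟨T, fun x hx => ?_⟩
      refine hI.mem_normalizer_of_coprime hG hL hpj hj hr (h1.le.trans hPQ) hu hmax ?_ x.2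
      obtain ⟨k, hk⟩ := IsPGroup.exists_pow_eq_one T.2 hx
      rw [Subgroup.coe_subtype, Subgroup.orderOf_coe]
      refine Nat.Coprime.coprime_dvd_right (orderOf_dvd_of_pow_eq_one hk) ?_
      exact Nat.Coprime.pow_right _ ((Nat.coprime_primes hp.out hq).2 (Ne.symm hqp))
  obtain ⟨P₃, hP₃, hI₃⟩ := hI.exists_le Q (P'.2.to_le inf_le_left) (inf_le_right.trans hNK)
  rw [← hQP, ← hI₃]
  exact hmax _ _ ((hcl h2).trans_le (Subgroup.card_le_of_le (le_inf hP₃ inf_le_left)))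

end SylowIntersections

section SylowBound

/-- If `w` is central in `P` then each element of the sink of `w` commutes with most of `P`. -/
theorem HasSinks.exists_relIndex_centralizer_engel_le {G : Type*} [Group G] {M : ℕ} (hG : HasSinks M G) {P : Subgroup G}
    {w : G} (hw : ∀ c ∈ P, w * c = c * w) :
    ∃ N, ∀ n ≥ N, ∀ x, (Subgroup.centralizer {engel w x n}).relIndex P ≤ M := by
  obtain ⟨R, hR, N, hN⟩ := hG w
  refine ⟨N, fun n hn x => le_trans ?_ hR⟩
  refine Subgroup.relIndex_le_of_map (fun c => c⁻¹ * engel w x n * c) R ?_ ?_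
  · intro c hc
    have := conj_engel c⁻¹ w x n
    rw [inv_inv] at this
    rw [this, show c⁻¹ * w * c = w by rw [mul_assoc, hw c hc]; group]
    exact hN _ n hn
  · intro d _ e _ hde
    rw [mem_centralizer_singleton]
    have h1 : d * (d⁻¹ * engel w x n * d) * e⁻¹ = d * (e⁻¹ * engel w x n * e) * e⁻¹ := by
      rw [show d⁻¹ * engel w x n * d = e⁻¹ * engel w x n * e from hde]
    simpa [mul_assoc] using h1.symm

variable {G : Type*} [Group G] [Finite G] {p : ℕ} [hp : Fact p.Prime]

theorem Sylow.lt_card_inf_centralizer {j₀ v : ℕ} (hexp : ∀ g : G, (∃ k, g ^ p ^ k = 1) →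
    orderOf g ≤ j₀) {P : Sylow p G} (hP : v ^ j₀ ^ j₀ * (v ^ j₀ ^ j₀)! < Nat.card P) {y : G}
    (hy : y ∈ P) : v < Nat.card ((P : Subgroup G) ⊓ Subgroup.centralizer {y} : Subgroup G) := by
  by_contra! hle
  have h1 : Nat.card (Subgroup.centralizer {(⟨y, hy⟩ : P)}) ≤ v := by
    refine le_trans ?_ hle
    refine Nat.card_le_card_of_injective (fun c => ⟨c.1.1, c.1.2, ?_⟩) ?_
    · have := mem_centralizer_singleton.1 c.2
      exact mem_centralizer_singleton.2 (congrArg Subtype.val this)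
    · intro a b hab
      exact Subtype.ext (Subtype.ext (congrArg (fun c => c.1) hab))
  have h2 := P.2.card_le_of_card_centralizer_le (j := j₀) ?_ ⟨y, hy⟩ h1
  · exact absurd hP (not_lt.2 h2)
  · intro g
    rw [← Subgroup.orderOf_coe]
    exact hexp g (IsPGroup.exists_pow_eq_one P.2 g.2)

theorem IsSylowInvariant.eq_of_mem {M j₀ j r : ℕ} {I : Sylow p G → Subgroup G}
    (hI : IsSylowInvariant r I) (hG : HasSinks M G) (hL : HasLocalCores p j G) (hpj : p ≤ j₀)
    (hj : 0 < j) (hr : M * j₀ ^ j ≤ r)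
    (hexp : ∀ g : G, (∃ k, g ^ p ^ k = 1) → orderOf g ≤ j₀)
    (hbig : ∀ P : Sylow p G, (r ! * j) ^ j₀ ^ j₀ * ((r ! * j) ^ j₀ ^ j₀)! < Nat.card P)
    {P P' : Sylow p G} {y : G} (hy1 : y ≠ 1) (hy : y ∈ P) (hy' : y ∈ P') : I P = I P' := by
  obtain ⟨O, hO, hOn, hOrel⟩ := hL y hy1
  obtain ⟨P₁, hP₁⟩ := hO.exists_le_sylow
  have key : ∀ P : Sylow p G, y ∈ P → I P = I P₁ := by
    intro P hy
    refine hI.eq_of_lt_card_inf hG hL hpj hj hr P P₁ ?_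
    have h1 := Sylow.lt_card_inf_centralizer hexp (hbig P) hy
    have h2 := Subgroup.card_lt_mul_of_relIndex_le
      (hOrel _ (P.2.to_le inf_le_left) inf_le_right) h1
    refine h2.trans_le (Subgroup.card_le_of_le (le_inf ?_ (inf_le_left.trans hP₁)))
    exact inf_le_right.trans inf_le_left
  rw [key P hy, key P' hy']

theorem IsSylowInvariant.mem_normalizer_of_cmtr_mem {r : ℕ} {I : Sylow p G → Subgroup G}
    (hI : IsSylowInvariant r I)
    (heq : ∀ (P P' : Sylow p G) (y : G), y ≠ 1 → y ∈ P → y ∈ P' → I P = I P') {P : Sylow p G}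
    {a x : G} (hx1 : x ≠ 1) (hx : x ∈ P) (h : cmtr a x ∈ Subgroup.normalizer (I P : Set G)) :
    a ∈ Subgroup.normalizer (I P : Set G) := by
  set K := Subgroup.normalizer (I P : Set G) with hK
  have hxK : x ∈ K := hI.le_normalizer P hx
  have h1 : a⁻¹ * x * a ∈ K := by
    have : a⁻¹ * x * a = x * (cmtr a x)⁻¹ := by simp [cmtr, mul_assoc]
    rw [this]
    exact K.mul_mem hxK (K.inv_mem h)
  have hxa : a⁻¹ * x * a ∈ a⁻¹ • P := by
    rw [Sylow.mem_smul_iff]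
    simpa [mul_assoc] using hx
  have hp1 := (a⁻¹ • P).2.to_le (H := Subgroup.zpowers (a⁻¹ * x * a))
    (by rwa [Subgroup.zpowers_le])
  obtain ⟨P₁, hP₁, hI₁⟩ := hI.exists_le P hp1 (by rwa [Subgroup.zpowers_le])
  have h2 := heq (a⁻¹ • P) P₁ (a⁻¹ * x * a) (by
    intro h
    apply hx1
    have : a * (a⁻¹ * x * a) * a⁻¹ = x := by group
    rw [← this, h]; group) hxa (hP₁ (Subgroup.mem_zpowers _))
  have h3 : a⁻¹ ∈ K := (hI.mem_normalizer_iff P a⁻¹).2 (h2.trans hI₁)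
  simpa using K.inv_mem h3

theorem IsSylowInvariant.mem_normalizer_of_engel_eq_one {r : ℕ} {I : Sylow p G → Subgroup G}
    (hI : IsSylowInvariant r I)
    (heq : ∀ (P P' : Sylow p G) (y : G), y ≠ 1 → y ∈ P → y ∈ P' → I P = I P') {P : Sylow p G}
    {w x : G} (hx1 : x ≠ 1) (hx : x ∈ P) {n : ℕ} (h : engel w x n = 1) :
    w ∈ Subgroup.normalizer (I P : Set G) := by
  have key : ∀ i ≤ n, engel w x (n - i) ∈ Subgroup.normalizer (I P : Set G) := by
    intro i
    induction i with
    | zero => intro _; rw [Nat.sub_zero, h]; exact one_mem _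
    | succ i ih =>
      intro hi
      refine hI.mem_normalizer_of_cmtr_mem heq hx1 hx ?_
      have := ih (by omega)
      rwa [show n - i = n - (i + 1) + 1 by omega, engel] at this
  simpa [engel] using key n le_rfl

theorem IsSylowInvariant.eq_of_mem_normalizer {r : ℕ} {I : Sylow p G → Subgroup G}
    (hI : IsSylowInvariant r I)
    (heq : ∀ (P P' : Sylow p G) (y : G), y ≠ 1 → y ∈ P → y ∈ P' → I P = I P') {P P' : Sylow p G}
    {w : G} (hw1 : w ≠ 1) (hw : w ∈ P') (h : w ∈ Subgroup.normalizer (I P : Set G)) :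
    I P = I P' := by
  obtain ⟨P₁, hP₁, hI₁⟩ := hI.exists_le P (P'.2.to_le (H := Subgroup.zpowers w)
    (by rwa [Subgroup.zpowers_le])) (by rwa [Subgroup.zpowers_le])
  rw [← hI₁]
  exact heq _ _ w hw1 (hP₁ (Subgroup.mem_zpowers _)) hw

theorem card_sylow_le {M j₀ j r : ℕ} (hG : HasSinks M G) (hL : HasLocalCores p j G) (hj : 0 < j)
    (hr0 : 0 < r) (hr : M * j₀ ^ j ≤ r)
    (hexp : ∀ g : G, (∃ k, g ^ p ^ k = 1) → orderOf g ≤ j₀) (hcore : pcore p G = ⊥)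
    (P : Sylow p G) :
    Nat.card P ≤ (r ^ j)! + j + (r ! * j) ^ j₀ ^ j₀ * ((r ! * j) ^ j₀ ^ j₀)! +
      r ! * j * (M * M) := by
  by_contra! hlt
  obtain ⟨I, hIdef⟩ : ∃ I : Sylow p G → Subgroup G, I = fun P : Sylow p G => nearCore r (P : Subgroup G) :=
    ⟨_, rfl⟩
  have hI : IsSylowInvariant r I := hIdef ▸ isSylowInvariant_nearCore p r
  have hcard : ∀ P' : Sylow p G, Nat.card P' = Nat.card P := fun P' => by
    rw [P'.card_eq_multiplicity, P.card_eq_multiplicity]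
  have hnt : ∀ P' : Sylow p G, Nontrivial P' := fun P' => by
    rw [← Finite.one_lt_card_iff_nontrivial, hcard]; omega
  have hpj : p ≤ j₀ := by
    obtain ⟨k, hk, hc⟩ := P.2.nontrivial_iff_card.1 (hnt P)
    obtain ⟨g, hg⟩ := exists_prime_orderOf_dvd_card' (G := P) p
      (by rw [hc]; exact dvd_pow_self p hk.ne')
    rw [← hg, ← Subgroup.orderOf_coe]
    exact hexp g (IsPGroup.exists_pow_eq_one P.2 g.2)
  have heq : ∀ (P P' : Sylow p G) (y : G), y ≠ 1 → y ∈ P → y ∈ P' → I P = I P' :=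
    fun P P' y hy1 hy hy' => hI.eq_of_mem hG hL hpj hj hr hexp
      (fun P' => by rw [hcard P']; omega) hy1 hy hy'
  have hbig : ∀ Q : Sylow p G, r ! * j * (M * M) < Nat.card (Q : Subgroup G) := fun Q => by
    have : Nat.card (Q : Subgroup G) = Nat.card P := hcard Q
    omega
  have hall : ∀ P P' : Sylow p G, I P = I P' := by
    intro P P'
    obtain ⟨⟨x, hx⟩, hx1⟩ := exists_ne (1 : P)
    have hx1' : x ≠ 1 := fun h => hx1 (Subtype.ext h)
    have := hnt P'
    have := IsPGroup.center_nontrivial P'.2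
    obtain ⟨⟨⟨w, hw⟩, hwc⟩, hw1⟩ := exists_ne (1 : Subgroup.center P')
    have hw1' : w ≠ 1 := fun h => hw1 (Subtype.ext (Subtype.ext h))
    have hwc' : ∀ c ∈ (P' : Subgroup G), w * c = c * w := fun c hc =>
      (congrArg Subtype.val (Subgroup.mem_center_iff.1 hwc ⟨c, hc⟩)).symm
    by_cases hE : ∃ n, engel w x n = 1
    · obtain ⟨n, hn⟩ := hE
      exact hI.eq_of_mem_normalizer heq hw1' hw (hI.mem_normalizer_of_engel_eq_one heq hx1' hx hn)
    push Not at hE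
    refine (hI.eq_of_mem_normalizer heq hx1' hx ?_).symm
    obtain ⟨N, hN⟩ := hG.exists_relIndex_centralizer_engel_le hwc'
    set z := engel w x N with hz
    set z' := engel w x (N + 1) with hz'
    have hzz : x⁻¹ * z * x = z * z' := by
      rw [hz', engel, ← hz]; simp [cmtr, mul_assoc]
    set D := (P' : Subgroup G) ⊓ (Subgroup.centralizer {z} ⊓ Subgroup.centralizer {z'}) with hD
    have hDcard : r ! * j < Nat.card D := by
      have h1 : (Subgroup.centralizer {z} ⊓ Subgroup.centralizer {z'}).relIndex P' ≤ M * M :=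
        Subgroup.relIndex_inf_le.trans
          (Nat.mul_le_mul (hN N le_rfl x) (hN (N + 1) (Nat.le_succ N) x))
      have h2 := Subgroup.card_lt_mul_of_relIndex_le (u := r ! * j) h1 (hbig P')
      rwa [inf_comm] at h2
    have hDz : D ≤ Subgroup.centralizer {z} := inf_le_right.trans inf_le_left
    have hDP : D ≤ P' := inf_le_left
    obtain ⟨O, hO, hOn, hOrel⟩ := hL z (hE N)
    obtain ⟨P₁, hP₁⟩ := hO.exists_le_sylow
    have key : ∀ Q : Sylow p G, ∀ D' : Subgroup G, D' ≤ Q → D' ≤ Subgroup.centralizer {z} →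
        r ! * j < Nat.card D' → I Q = I P₁ := by
      intro Q D' hQ hz hc
      refine hI.eq_of_lt_card_inf hG hL hpj hj hr Q P₁ ?_
      have h2 := Subgroup.card_lt_mul_of_relIndex_le (hOrel _ (Q.2.to_le hQ) hz) hc
      exact h2.trans_le (Subgroup.card_le_of_le (le_inf (inf_le_right.trans hQ)
        (inf_le_left.trans hP₁)))
    rw [hI.mem_normalizer_iff, key P' D hDP hDz hDcard]
    refine key (x • P') (D.map (MulAut.conj x).toMonoidHom) ?_ ?_ ?_
    · rintro _ ⟨c, hc, rfl⟩
      change _ ∈ x • P'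
      rw [Sylow.mem_smul_iff]
      have : x⁻¹ * (x * c * x⁻¹) * x = c := by group
      change x⁻¹ * (x * c * x⁻¹) * x ∈ (P' : Subgroup G)
      rw [this]
      exact hDP hc
    · rintro _ ⟨c, hc, rfl⟩
      have h1 : c * z = z * c := mem_centralizer_singleton.1 hc.2.1
      have h2 : c * z' = z' * c := mem_centralizer_singleton.1 hc.2.2
      have h3 : c * (x⁻¹ * z * x) = (x⁻¹ * z * x) * c := by
        rw [hzz, ← mul_assoc, h1, mul_assoc, h2, mul_assoc]
      rw [mem_centralizer_singleton]
      change x * c * x⁻¹ * z = z * (x * c * x⁻¹)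
      calc x * c * x⁻¹ * z = x * (c * (x⁻¹ * z * x)) * x⁻¹ := by group
        _ = x * ((x⁻¹ * z * x) * c) * x⁻¹ := by rw [h3]
        _ = z * (x * c * x⁻¹) := by group
    · rwa [Nat.card_congr (D.equivMapOfInjective _ (MulAut.conj x).injective).toEquiv.symm]
  have hnorm : (I P).Normal := by
    rw [← Subgroup.normalizer_eq_top_iff, eq_top_iff]
    intro g _
    exact (hI.mem_normalizer_iff P g).2 (hall _ _)
  have hle : I P ≤ pcore p G := by
    refine le_pcore (P.2.to_le ?_)
    rw [hIdef]; exact invCore_le _ _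
  rw [hcore, le_bot_iff, hIdef] at hle
  exact nearCore_ne_bot hr0 hL P (by omega) (by omega) hle

end SylowBound

section ReducedBound

theorem IndexBound.mono {m h h' : ℕ} (hT : IndexBound.{u} m h) (hh : h ≤ h') :
    IndexBound.{u} m h' := by
  intro G _ _ hG
  obtain ⟨c, hc⟩ := hT G hG
  exact ⟨c, hc.trans hh⟩

theorem IndexBound.exists_card_le_of_pcore_eq_bot {m h : ℕ} (hT : IndexBound.{u} m h) :
    ∃ B, 0 < B ∧ ∀ (G : Type u) [Group G] [Finite G], HasSinks (m + 1) G →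
      (∀ q, q.Prime → pcore q G = ⊥) → Nat.card G ≤ B := by
  set j₀ := (h + 1) * (m + 1) ^ (m + 1) with hj₀
  set j := j₀ ! with hj
  have hj0 : 0 < j := Nat.factorial_pos _
  have hj₀0 : 0 < j₀ := by positivity
  set r := (m + 1) * j₀ ^ j with hr
  have hr0 : 0 < r := by positivity
  set β := (r ^ j)! + j + (r ! * j) ^ j₀ ^ j₀ * ((r ! * j) ^ j₀ ^ j₀)! +
      r ! * j * ((m + 1) * (m + 1)) with hβ
  have hβ0 : 0 < β := by omega
  have hT' := hT.mono (Nat.le_succ h)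
  refine ⟨β ^ (j₀ + 1), by positivity, ?_⟩
  intro G _ _ hG hcore
  have hexp : ∀ p, p.Prime → ∀ g : G, (∃ k, g ^ p ^ k = 1) → orderOf g ≤ j₀ := by
    intro p hp g hg
    have : Fact p.Prime := ⟨hp⟩
    exact orderOf_le_of_pcore_eq_bot hG hT' (hcore p hp) (Nat.succ_pos h) hg
  refine card_le_pow_of_sylow_le hβ0 ?_ ?_
  · intro p hp hd
    have : Fact p.Prime := ⟨hp⟩
    obtain ⟨g, hg⟩ := exists_prime_orderOf_dvd_card' (G := G) p hd
    rw [← hg]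
    exact hexp p hp g ⟨1, by rw [pow_one, ← hg, pow_orderOf_eq_one]⟩
  · intro p hp P
    have : Fact p.Prime := ⟨hp⟩
    exact card_sylow_le hG (hasLocalCores_of_pcore_eq_bot hG hT' hcore p) hj0 hr0 hr.ge
      (hexp p hp) (hcore p hp) P

end ReducedBound

section Transversals

variable {G : Type*} [Group G]

theorem index_centralizer_le_of_forall_conj_mem (S : Finset G)
    (hS : ∀ g, ∀ s ∈ S, g⁻¹ * s * g ∈ S) :
    (Subgroup.centralizer (S : Set G)).index ≤ S.card ^ S.card := by
  have h1 : ∀ s ∈ S, (Subgroup.centralizer {s}).relIndex ⊤ ≤ S.card := by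
    intro s hs
    refine Subgroup.relIndex_le_of_map (fun g => g⁻¹ * s * g) S (fun g _ => hS g s hs) ?_
    intro d _ e _ hde
    rw [mem_centralizer_singleton]
    have h1 : d * (d⁻¹ * s * d) * e⁻¹ = d * (e⁻¹ * s * e) * e⁻¹ := by
      rw [show d⁻¹ * s * d = e⁻¹ * s * e from hde]
    simpa [mul_assoc] using h1.symm
  have h2 := relIndex_biInf_le ⊤ S h1
  rw [Subgroup.relIndex_top_right] at h2
  refine le_trans (le_of_eq ?_) h2
  congr 1
  ext g
  simp only [Subgroup.mem_iInf, mem_centralizer_singleton]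
  rw [Subgroup.mem_centralizer_iff]
  exact forall₂_congr fun _ _ => eq_comm

theorem normal_centralizer_of_forall_conj_mem {S : Set G} (hS : ∀ g, ∀ s ∈ S, g⁻¹ * s * g ∈ S) :
    (Subgroup.centralizer S).Normal := by
  refine ⟨fun c hc g => ?_⟩
  rw [Subgroup.mem_centralizer_iff] at hc ⊢
  intro s hs
  have h := hc _ (hS g s hs)
  calc s * (g * c * g⁻¹) = g * (g⁻¹ * s * g * c) * g⁻¹ := by group
    _ = g * c * g⁻¹ * s := by rw [h]; group

variable [Finite G]

theorem Subgroup.exists_finset_transversal (C D : Subgroup G) :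
    ∃ T : Finset G, T.card ≤ C.relIndex D ∧ (∀ t ∈ T, t ∈ D) ∧ ∀ d ∈ D, ∃ t ∈ T, d * t⁻¹ ∈ C := by
  classical
  have := Fintype.ofFinite (D ⧸ C.subgroupOf D)
  refine ⟨Finset.univ.image fun q : D ⧸ C.subgroupOf D => ((q.out : D) : G)⁻¹, ?_, ?_, ?_⟩
  · refine Finset.card_image_le.trans (le_of_eq ?_)
    rw [Finset.card_univ, ← Nat.card_eq_fintype_card]
    rfl
  · intro t ht
    obtain ⟨q, -, rfl⟩ := Finset.mem_image.1 ht
    exact D.inv_mem q.out.2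
  · intro d hd
    refine ⟨_, Finset.mem_image.2
      ⟨((⟨d, hd⟩⁻¹ : D) : D ⧸ C.subgroupOf D), Finset.mem_univ _, rfl⟩, ?_⟩
    have h1 := QuotientGroup.eq.1 (Quotient.out_eq' ((⟨d, hd⟩⁻¹ : D) : D ⧸ C.subgroupOf D))
    have h2 := C.inv_mem (Subgroup.mem_subgroupOf.1 h1)
    simpa using h2

theorem exists_finset_conj (V : Subgroup G) (r : G) :
    ∃ Y : Finset G, Y.card ≤ (Subgroup.centralizer {r}).relIndex V ∧
      (∀ v ∈ V, v⁻¹ * r * v ∈ Y) ∧ ∀ y ∈ Y, ∃ v ∈ V, y = v⁻¹ * r * v := by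
  classical
  obtain ⟨T, hT, hTV, hTC⟩ := (Subgroup.centralizer {r}).exists_finset_transversal V
  refine ⟨T.image fun t => t⁻¹ * r * t, Finset.card_image_le.trans hT, ?_, ?_⟩
  · intro v hv
    obtain ⟨t, ht, hc⟩ := hTC v hv
    refine Finset.mem_image.2 ⟨t, ht, ?_⟩
    rw [mem_centralizer_singleton] at hc
    have h1 : v * t⁻¹ * r * t = r * v := by rw [hc]; group
    calc t⁻¹ * r * t = v⁻¹ * (v * t⁻¹ * r * t) := by group
      _ = v⁻¹ * r * v := by rw [h1, mul_assoc]
  · intro y hy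
    obtain ⟨t, ht, rfl⟩ := Finset.mem_image.1 hy
    exact ⟨t, hTV t ht, rfl⟩

/-- If `G` has a normal `p`-subgroup of index at most `b`, then boundedly many `p'`-elements
generate a subgroup containing all `p'`-elements. -/
theorem exists_finset_closure_of_coprime {p : ℕ} [hp : Fact p.Prime] {M b : ℕ}
    (hG : HasSinks M G) {V : Subgroup G} [hVn : V.Normal] (hV : IsPGroup p V)
    (hb : V.index ≤ b) :
    ∃ Y : Finset G, Y.card ≤ b * M ∧ (∀ y ∈ Y, p.Coprime (orderOf y)) ∧
      ∀ x, p.Coprime (orderOf x) → x ∈ Subgroup.closure (Y : Set G) := by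
  classical
  have hnorm : ∀ x : G, x ∈ Subgroup.normalizer (V : Set G) := fun x => by
    rw [Subgroup.normalizer_eq_top_iff.2 hVn]; trivial
  obtain ⟨T, hT, -, hTV⟩ := V.exists_finset_transversal ⊤
  rw [Subgroup.relIndex_top_right] at hT
  have hr : ∀ t : G, ∃ r, p.Coprime (orderOf r) ∧
      ((∃ x, p.Coprime (orderOf x) ∧ x * t⁻¹ ∈ V) → r * t⁻¹ ∈ V) := by
    intro t
    by_cases h : ∃ x, p.Coprime (orderOf x) ∧ x * t⁻¹ ∈ V
    · obtain ⟨x, hx, hxt⟩ := h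
      exact ⟨x, hx, fun _ => hxt⟩
    · exact ⟨1, by simp, fun h' => absurd h' h⟩
  choose r hr1 hr2 using hr
  choose Y hY1 hY2 hY3 using fun t => exists_finset_conj V (r t)
  have hcop : ∀ y ∈ T.biUnion Y, p.Coprime (orderOf y) := by
    intro y hy
    obtain ⟨t, -, hy⟩ := Finset.mem_biUnion.1 hy
    obtain ⟨v, -, rfl⟩ := hY3 t y hy
    have : orderOf (v⁻¹ * r t * v) = orderOf (r t) := by
      have := (MulAut.conj v⁻¹).orderOf_eq (r t)
      simpa using this
    rw [this]; exact hr1 t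
  refine ⟨T.biUnion Y, ?_, hcop, ?_⟩
  · refine (Finset.card_biUnion_le_card_mul T Y M fun t _ => ?_).trans
      (Nat.mul_le_mul_right _ (hT.trans hb))
    exact (hY1 t).trans (IsPGroup.relIndex_centralizer_le hG hV (hr1 t) (hnorm _))
  intro x hx
  set Λ := Subgroup.closure (T.biUnion Y : Set G) with hΛ
  have hVΛ : V ≤ Subgroup.normalizer (Λ : Set G) := by
    intro v hv
    refine Subgroup.normalizer_le_normalizer_closure _ ?_
    rw [Subgroup.mem_set_normalizer_iff]
    have key : ∀ v ∈ V, ∀ y, y ∈ T.biUnion Y → v * y * v⁻¹ ∈ T.biUnion Y := by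
      intro v hv y hy
      obtain ⟨t, ht, hy⟩ := Finset.mem_biUnion.1 hy
      obtain ⟨w, hw, rfl⟩ := hY3 t y hy
      refine Finset.mem_biUnion.2 ⟨t, ht, ?_⟩
      have := hY2 t (w * v⁻¹) (V.mul_mem hw (V.inv_mem hv))
      simpa [mul_assoc] using this
    intro y
    refine ⟨fun hy => key v hv y hy, fun hy => ?_⟩
    have := key v⁻¹ (V.inv_mem hv) _ hy
    simpa [mul_assoc] using this
  obtain ⟨t, ht, hxt⟩ := hTV x trivial
  have hrt := hr2 t ⟨x, hx, hxt⟩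
  have hrΛ : r t ∈ Λ := Subgroup.subset_closure (Finset.mem_coe.2
    (Finset.mem_biUnion.2 ⟨t, ht, by simpa using hY2 t 1 (one_mem _)⟩))
  obtain ⟨v, hv, rfl⟩ : ∃ v ∈ V, x = v * r t := by
    refine ⟨x * (r t)⁻¹, ?_, by group⟩
    have := V.mul_mem hxt (V.inv_mem hrt)
    simpa using this
  set N := Subgroup.normalizer (Λ : Set G) with hN
  have hΛN : Λ ≤ N := Subgroup.le_normalizer
  let π := QuotientGroup.mk' (Λ.subgroupOf N)
  have h1 : π (⟨v, hVΛ hv⟩ * ⟨r t, hΛN hrΛ⟩) = π ⟨v, hVΛ hv⟩ := by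
    rw [map_mul]
    have : π ⟨r t, hΛN hrΛ⟩ = 1 := (QuotientGroup.eq_one_iff _).2 hrΛ
    rw [this, mul_one]
  obtain ⟨k, hk⟩ := hV.exists_pow_eq_one hv
  have h2 : (v * r t) ^ p ^ k ∈ Λ := by
    have h3 : π ((⟨v, hVΛ hv⟩ * ⟨r t, hΛN hrΛ⟩) ^ p ^ k) = 1 := by
      rw [map_pow, h1, ← map_pow]
      have : (⟨v, hVΛ hv⟩ : N) ^ p ^ k = 1 := Subtype.ext hk
      rw [this, map_one]
    have h4 := (QuotientGroup.eq_one_iff (N := Λ.subgroupOf N)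
      ((⟨v, hVΛ hv⟩ * ⟨r t, hΛN hrΛ⟩ : N) ^ p ^ k)).1 h3
    exact h4
  obtain ⟨s, hs⟩ := exists_pow_eq_self_of_coprime (Nat.Coprime.pow_left k hx)
  rw [← hs]
  exact Λ.pow_mem h2 s

end Transversals

section NormalPSubgroups

variable {G : Type*} [Group G] [Finite G] {p : ℕ} [hp : Fact p.Prime] {M : ℕ}

theorem eq_one_of_forall_coprime_commute (hZ : Subgroup.center G = ⊥) {d : G}
    (hd : d ∈ pcore p G) (h : ∀ x : G, p.Coprime (orderOf x) → d * x = x * d) : d = 1 := by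
  set X : Set G := {x | p.Coprime (orderOf x)} with hX
  have hXn : (Subgroup.centralizer X).Normal := by
    refine normal_centralizer_of_forall_conj_mem fun g s hs => ?_
    have : orderOf (g⁻¹ * s * g) = orderOf s := by
      simpa using (MulAut.conj g⁻¹).orderOf_eq s
    change p.Coprime _
    rw [this]; exact hs
  have hDn := pcore_normal (G := G) p
  set N := pcore p G ⊓ Subgroup.centralizer X with hN
  have hNn : N.Normal := Subgroup.normal_inf_normal _ _
  have hdN : d ∈ N := ⟨hd, Subgroup.mem_centralizer_iff.2 fun x hx => (h x hx).symm⟩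
  by_contra hd1
  have hne : N ≠ ⊥ := fun h0 => hd1 (by rw [h0] at hdN; exact hdN)
  have hNp : IsPGroup p N := (isPGroup_pcore p).to_le inf_le_left
  let P : Sylow p G := default
  obtain ⟨e, heN, he1, he⟩ := P.2.exists_fixed_of_le_normalizer hNp hne
    (by rw [Subgroup.normalizer_eq_top_iff.2 hNn]; exact le_top)
  have htop : Subgroup.centralizer {e} = ⊤ := by
    refine Subgroup.eq_top_of_forall_sylow_le fun q hq => ?_
    by_cases hqp : q = p
    · subst hqp
      exact ⟨P, fun x hx => mem_centralizer_singleton.2 (he x hx).symm⟩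
    · have : Fact q.Prime := ⟨hq⟩
      refine ⟨default, fun x hx => mem_centralizer_singleton.2 ?_⟩
      refine (Subgroup.mem_centralizer_iff.1 heN.2 x ?_)
      obtain ⟨k, hk⟩ := (default : Sylow q G).2.exists_pow_eq_one hx
      exact Nat.Coprime.coprime_dvd_right (orderOf_dvd_of_pow_eq_one hk)
        (Nat.Coprime.pow_right k ((Nat.coprime_primes hp.out hq).2 (Ne.symm hqp)))
  have hec : e ∈ Subgroup.center G := by
    rw [Subgroup.mem_center_iff]
    intro g
    have : g ∈ Subgroup.centralizer {e} := htop ▸ Subgroup.mem_top g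
    exact mem_centralizer_singleton.1 this
  rw [hZ] at hec
  exact he1 hec

theorem pcore_eq_bot_of_lt (hG : HasSinks M G) (hZ : Subgroup.center G = ⊥) (hM : M < p) :
    pcore p G = ⊥ := by
  have hDn := pcore_normal (G := G) p
  rw [Subgroup.eq_bot_iff_forall]
  intro d hd
  refine eq_one_of_forall_coprime_commute hZ hd fun x hx => ?_
  have h1 : (Subgroup.centralizer {x}).relIndex (pcore p G) ≤ M :=
    IsPGroup.relIndex_centralizer_le hG (isPGroup_pcore p) hx
      (by rw [Subgroup.normalizer_eq_top_iff.2 hDn]; trivial)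
  obtain ⟨n, hn⟩ := IsPGroup.iff_card.1 (isPGroup_pcore (G := G) p)
  have h2 := Subgroup.relIndex_dvd_card (Subgroup.centralizer {x}) (pcore p G)
  rw [hn] at h2
  obtain ⟨i, -, hi⟩ := (Nat.dvd_prime_pow hp.out).1 h2
  have h3 : i = 0 := by
    by_contra h0
    have : p ≤ p ^ i := Nat.le_self_pow h0 p
    omega
  rw [h3, pow_zero, Subgroup.relIndex_eq_one] at hi
  exact mem_centralizer_singleton.1 (hi hd)

/-- Commutators of elements of a normal `p`-subgroup with `p'`-elements take boundedly many
values. -/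
theorem IsPGroup.exists_finset_forall_cmtr (hG : HasSinks M G) {D : Subgroup G} [hDn : D.Normal]
    (hD : IsPGroup p D) :
    ∃ S : Finset G, S.card ≤ M ^ M * (M * M * M) ∧
      (∀ d ∈ D, ∀ x, p.Coprime (orderOf x) → cmtr d x ∈ S) ∧
      ∀ s ∈ S, ∃ d ∈ D, ∃ x, p.Coprime (orderOf x) ∧ s = cmtr d x := by
  classical
  have := Fintype.ofFinite G
  have hM := hG.pos
  have hnorm : ∀ x : G, x ∈ Subgroup.normalizer (D : Set G) := fun x => by
    rw [Subgroup.normalizer_eq_top_iff.2 hDn]; trivial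
  let X : Finset G := Finset.univ.filter fun x => p.Coprime (orderOf x)
  have hX : ∀ x, x ∈ X ↔ p.Coprime (orderOf x) := fun x => by simp [X]
  let Γ : G → Finset G := fun d => X.image (cmtr d)
  have hΓ : ∀ d x, p.Coprime (orderOf x) → cmtr d x ∈ Γ d := fun d x hx =>
    Finset.mem_image_of_mem _ ((hX x).2 hx)
  have hΓcard : ∀ d ∈ D, (Γ d).card ≤ M := by
    intro d hd
    obtain ⟨R, hR, hRd⟩ := hD.exists_finset_cmtr hG hd
    refine (Finset.card_le_card fun y hy => ?_).trans hR
    obtain ⟨x, hx, rfl⟩ := Finset.mem_image.1 hy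
    exact hRd x ((hX x).1 hx) (hnorm x)
  obtain ⟨d, hdD, hdmax⟩ := Finset.exists_max_image (Finset.univ.filter (· ∈ D))
    (fun d => (Γ d).card) ⟨1, by simp⟩
  replace hdD : d ∈ D := by simpa using hdD
  replace hdmax : ∀ e ∈ D, (Γ e).card ≤ (Γ d).card := fun e he => hdmax e (by simpa using he)
  have hrep : ∀ γ : G, ∃ x, γ ∈ Γ d → x ∈ X ∧ cmtr d x = γ := by
    intro γ
    by_cases h : γ ∈ Γ d
    · obtain ⟨x, hx⟩ := Finset.mem_image.1 h
      exact ⟨x, fun _ => hx⟩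
    · exact ⟨1, fun h' => absurd h' h⟩
  choose ρ hρ using hrep
  set C : Subgroup G := ⨅ μ ∈ (Γ d).image ρ, Subgroup.centralizer {μ} with hC
  have hCi : C.relIndex D ≤ M ^ M := by
    refine (relIndex_biInf_le (r := M) D ((Γ d).image ρ) fun μ hμ => ?_).trans
      (Nat.pow_le_pow_right hM (Finset.card_image_le.trans (hΓcard d hdD)))
    obtain ⟨γ, hγ, rfl⟩ := Finset.mem_image.1 hμ
    exact IsPGroup.relIndex_centralizer_le hG hD ((hX _).1 (hρ γ hγ).1) (hnorm _)
  have hmul : ∀ a b x : G, cmtr (a * b) x = b⁻¹ * cmtr a x * b * cmtr b x := by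
    intro a b x; simp only [cmtr]; group
  have hΓeq : ∀ c ∈ C, c ∈ D → Γ (c * d) = Γ d := by
    intro c hc hcD
    refine (Finset.eq_of_subset_of_card_le (fun γ hγ => ?_) (hdmax _ (D.mul_mem hcD hdD))).symm
    obtain ⟨h1, h2⟩ := hρ γ hγ
    have h3 : c * ρ γ = ρ γ * c := by
      simp only [hC, Subgroup.mem_iInf] at hc
      exact mem_centralizer_singleton.1 (hc _ (Finset.mem_image_of_mem _ hγ))
    have h4 : cmtr (c * d) (ρ γ) = γ := by
      rw [hmul, (cmtr_eq_one_iff).2 h3, h2]; simp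
    rw [← h4]
    exact hΓ _ _ ((hX _).1 h1)
  obtain ⟨T, hT, hTD, hTC⟩ := C.exists_finset_transversal D
  let S : Finset G := ((Finset.univ.filter (· ∈ D)) ×ˢ X).image fun q => cmtr q.1 q.2
  refine ⟨S, ?_, ?_, ?_⟩
  · have hsub : S ⊆ T.biUnion fun t => ((Γ d ×ˢ Γ d) ×ˢ Γ t).image fun q =>
        t⁻¹ * (d * (q.1.1 * q.1.2⁻¹) * d⁻¹) * t * q.2 := by
      intro s hs
      obtain ⟨⟨e, x⟩, hq, rfl⟩ := Finset.mem_image.1 hs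
      rw [Finset.mem_product] at hq
      have heD : e ∈ D := by simpa using hq.1
      have hx := (hX x).1 hq.2
      obtain ⟨t, ht, hc⟩ := hTC e heD
      have hcD : e * t⁻¹ ∈ D := D.mul_mem heD (D.inv_mem (hTD t ht))
      refine Finset.mem_biUnion.2 ⟨t, ht, Finset.mem_image.2
        ⟨((cmtr (e * t⁻¹ * d) x, cmtr d x), cmtr t x), ?_, ?_⟩⟩
      · refine Finset.mem_product.2 ⟨Finset.mem_product.2 ⟨?_, hΓ _ _ hx⟩, hΓ _ _ hx⟩
        change cmtr (e * t⁻¹ * d) x ∈ Γ d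
        rw [← hΓeq _ hc hcD]
        exact hΓ _ _ hx
      · have h1 : cmtr e x = t⁻¹ * cmtr (e * t⁻¹) x * t * cmtr t x := by
          rw [← hmul]; simp
        change _ = cmtr e x
        rw [h1, hmul (e * t⁻¹) d]
        group
    refine (Finset.card_le_card hsub).trans ((Finset.card_biUnion_le_card_mul T _ (M * M * M)
      fun t ht => Finset.card_image_le.trans ?_).trans (Nat.mul_le_mul_right _ (hT.trans hCi)))
    rw [Finset.card_product, Finset.card_product]
    exact Nat.mul_le_mul (Nat.mul_le_mul (hΓcard d hdD) (hΓcard d hdD)) (hΓcard t (hTD t ht))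
  · intro e he x hx
    exact Finset.mem_image.2 ⟨(e, x), Finset.mem_product.2 ⟨by simpa using he, (hX x).2 hx⟩, rfl⟩
  · intro s hs
    obtain ⟨⟨e, x⟩, hq, rfl⟩ := Finset.mem_image.1 hs
    rw [Finset.mem_product] at hq
    exact ⟨e, by simpa using hq.1, x, (hX x).1 hq.2, rfl⟩

theorem exists_coprime_lift {H : Type*} [Group H] [Finite H] {f : G →* H}
    (hf : Function.Surjective f) {y : H} (hy : p.Coprime (orderOf y)) :
    ∃ x, p.Coprime (orderOf x) ∧ f x = y := by
  obtain ⟨g, rfl⟩ := hf y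
  obtain ⟨i, j, ⟨k, hk⟩, hj, hij⟩ := exists_pParts p g
  refine ⟨g ^ j, hj, ?_⟩
  have h1 : f (g ^ i) = 1 := by
    refine eq_one_of_pow_eq_one_of_coprime (p := p) (k := k) (n := orderOf (f g)) ?_ ?_ hy
    · rw [← map_pow, hk, map_one]
    · rw [map_pow, ← pow_mul, mul_comm, pow_mul, pow_orderOf_eq_one, one_pow]
  have h2 : f (g ^ i * g ^ j) = f g := by rw [hij]
  rwa [map_mul, h1, one_mul] at h2

theorem card_pcore_le (hG : HasSinks M G) (hZ : Subgroup.center G = ⊥) {K : ℕ}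
    (hK : K = M ^ M * (M * M * M)) : Nat.card (pcore p G) ≤ M ^ (K ^ K * M) := by
  classical
  have hM := hG.pos
  have hK0 : 0 < K := by rw [hK]; positivity
  set D := pcore p G with hDdef
  have hDn : D.Normal := pcore_normal p
  have hD : IsPGroup p D := isPGroup_pcore p
  have hnorm : ∀ x : G, x ∈ Subgroup.normalizer (D : Set G) := fun x => by
    rw [Subgroup.normalizer_eq_top_iff.2 hDn]; trivial
  obtain ⟨S, hScard, hSmem, hS⟩ := hD.exists_finset_forall_cmtr hG
  rw [← hK] at hScard
  have hSconj : ∀ g, ∀ s ∈ S, g⁻¹ * s * g ∈ S := by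
    intro g s hs
    obtain ⟨d, hd, x, hx, rfl⟩ := hS s hs
    have h1 : g⁻¹ * cmtr d x * g = cmtr (g⁻¹ * d * g) (g⁻¹ * x * g) := by
      simp only [cmtr]; group
    rw [h1]
    refine hSmem _ (by simpa using hDn.conj_mem d hd g⁻¹) _ ?_
    have : orderOf (g⁻¹ * x * g) = orderOf x := by
      simpa using (MulAut.conj g⁻¹).orderOf_eq x
    rw [this]; exact hx
  set G₁ := Subgroup.centralizer (S : Set G) with hG₁
  have hG₁n : G₁.Normal := normal_centralizer_of_forall_conj_mem hSconj
  have hG₁i : G₁.index ≤ K ^ K :=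
    (index_centralizer_le_of_forall_conj_mem S hSconj).trans
      ((Nat.pow_le_pow_left hScard _).trans (Nat.pow_le_pow_right hK0 hScard))
  set A := Subgroup.centralizer (D : Set G) with hA
  have hAn : A.Normal := normal_centralizer_of_forall_conj_mem fun g s hs => by
    simpa using hDn.conj_mem s hs g⁻¹
  have hcent : ∀ x ∈ G₁, p.Coprime (orderOf x) → x ∈ A := by
    intro x hx hxp
    rw [hA, Subgroup.mem_centralizer_iff]
    intro d hd
    have hD' : ∀ d ∈ D, x⁻¹ * d * x ∈ D := fun d hd => by simpa using hDn.conj_mem d hd x⁻¹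
    refine cmtr_eq_one_iff.1 (hD.eq_one_of_cmtr_eq hxp hD' (cmtr_mem hD' hd) (one_mem D) hd
      (Subgroup.mem_centralizer_iff.1 hx _ (hSmem d hd x hxp)) ?_)
    rw [cmtr_one_left, mul_one]
  set π := QuotientGroup.mk' A with hπ
  have hπs : Function.Surjective π := QuotientGroup.mk'_surjective A
  set V := G₁.map π with hV
  have hVn : V.Normal := hG₁n.map π hπs
  have hVp : IsPGroup p V := by
    rintro ⟨_, g, hg, rfl⟩
    obtain ⟨i, j, ⟨k, hk⟩, hj, hij⟩ := exists_pParts p g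
    refine ⟨k, Subtype.ext ?_⟩
    have h1 : π (g ^ j) = 1 := (QuotientGroup.eq_one_iff _).2 (hcent _ (G₁.pow_mem hg j) hj)
    have h2 : π g = π (g ^ i) := by rw [← hij, map_mul, h1, mul_one, hij]
    change (π g) ^ p ^ k = 1
    rw [h2, ← map_pow, hk, map_one]
  have hVi : V.index ≤ K ^ K :=
    (Nat.le_of_dvd (Nat.pos_of_ne_zero Subgroup.index_ne_zero_of_finite)
      (Subgroup.index_map_dvd G₁ hπs)).trans hG₁i
  obtain ⟨Y, hYcard, hYp, hY⟩ := exists_finset_closure_of_coprime (hG.of_surjective π hπs) hVp hVi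
  have hlift : ∀ y : G ⧸ A, ∃ x : G, p.Coprime (orderOf y) → p.Coprime (orderOf x) ∧ π x = y := by
    intro y
    by_cases h : p.Coprime (orderOf y)
    · obtain ⟨x, hx⟩ := exists_coprime_lift hπs h
      exact ⟨x, fun _ => hx⟩
    · exact ⟨1, fun h' => absurd h' h⟩
  choose l hl using hlift
  have h1 := relIndex_biInf_le (r := M) D (Y.image l) fun μ hμ => by
    obtain ⟨y, hy, rfl⟩ := Finset.mem_image.1 hμ
    exact IsPGroup.relIndex_centralizer_le hG hD (hl y (hYp y hy)).1 (hnorm _)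
  have h2 : (⨅ μ ∈ Y.image l, Subgroup.centralizer {μ}) ⊓ D = ⊥ := by
    rw [Subgroup.eq_bot_iff_forall]
    rintro d ⟨hd, hdD⟩
    replace hd : d ∈ ⨅ μ ∈ Y.image l, Subgroup.centralizer {μ} := hd
    simp only [Subgroup.mem_iInf] at hd
    refine eq_one_of_forall_coprime_commute hZ hdD fun x hx => ?_
    have h3 : Subgroup.closure (Y : Set (G ⧸ A)) ≤ (Subgroup.centralizer {d}).map π := by
      rw [Subgroup.closure_le]
      intro y hy
      refine ⟨l y, ?_, (hl y (hYp y hy)).2⟩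
      have := mem_centralizer_singleton.1 (hd _ (Finset.mem_image_of_mem l hy))
      exact mem_centralizer_singleton.2 this.symm
    obtain ⟨c, hc, hcx⟩ := h3 (hY (π x)
      (Nat.Coprime.coprime_dvd_right (orderOf_map_dvd π x) hx))
    have h4 : c⁻¹ * x ∈ A := QuotientGroup.eq.1 hcx
    have h5 : c⁻¹ * x ∈ Subgroup.centralizer {d} :=
      mem_centralizer_singleton.2 (Subgroup.mem_centralizer_iff.1 h4 d hdD).symm
    have h6 := (Subgroup.centralizer {d}).mul_mem hc h5
    rw [mul_inv_cancel_left] at h6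
    exact (mem_centralizer_singleton.1 h6).symm
  rw [← Subgroup.inf_relIndex_right, h2, Subgroup.relIndex_bot_left] at h1
  exact h1.trans (Nat.pow_le_pow_right hM (Finset.card_image_le.trans hYcard))

end NormalPSubgroups

section CenterlessBound

variable {G : Type*} [Group G] [Finite G]

theorem pcore_characteristic (p : ℕ) : (pcore p G).Characteristic := by
  rw [Subgroup.characteristic_iff_map_le]
  intro f
  have := (pcore_normal (G := G) p).map f.toMonoidHom f.surjective
  exact le_pcore ((isPGroup_pcore p).map f.toMonoidHom)

theorem map_subtype_pcore_le (p : ℕ) (C : Subgroup G) [C.Normal] :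
    (pcore p C).map C.subtype ≤ pcore p G := by
  have := pcore_characteristic (G := C) p
  have : ((pcore p C).map C.subtype).Normal := ConjAct.normal_of_characteristic_of_normal
  exact le_pcore ((isPGroup_pcore p).map C.subtype)

theorem mem_pcore_of_mem_center {p : ℕ} [Fact p.Prime] {z : G} (hz : z ∈ Subgroup.center G)
    (hp : ∃ k, z ^ p ^ k = 1) : z ∈ pcore p G := by
  refine mem_pcore_of_mem_nilpotent (N := Subgroup.center G) (fun a ha y _ => ⟨1, ?_⟩) hz hp
  exact cmtr_eq_one_iff.2 (Subgroup.mem_center_iff.1 ha y).symm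

/-- If all elements of every `pcore` are central, then all `pcore`s of the central quotient are
trivial. -/
theorem pcore_quotient_center_eq_bot (h : ∀ q, q.Prime → pcore q G ≤ Subgroup.center G) {q : ℕ}
    (hq : q.Prime) : pcore q (G ⧸ Subgroup.center G) = ⊥ := by
  have : Fact q.Prime := ⟨hq⟩
  set π := QuotientGroup.mk' (Subgroup.center G) with hπ
  have hQp := isPGroup_pcore (G := G ⧸ Subgroup.center G) q
  have hQn := pcore_normal (G := G ⧸ Subgroup.center G) q
  set E := (pcore q (G ⧸ Subgroup.center G)).comap π with hE
  have hEn : E.Normal := hQn.comap π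
  have hker : ∀ x, π x = 1 → x ∈ Subgroup.center G := fun x hx => (QuotientGroup.eq_one_iff _).1 hx
  rw [Subgroup.eq_bot_iff_forall]
  intro e he
  obtain ⟨e, rfl⟩ := QuotientGroup.mk'_surjective _ e
  obtain ⟨i, j, hi, hj, hij⟩ := exists_pParts q e
  have heE : e ∈ E := he
  have h1 : e ^ i ∈ Subgroup.center G := by
    refine h q hq (mem_pcore_of_mem_nilpotent (N := E) (fun z hz y hy => ?_) (E.pow_mem heE i) hi)
    obtain ⟨n, hn⟩ := hQp.exists_engel_eq_one (a := π z) (x := π y) hz hy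
    rw [← map_engel] at hn
    exact ⟨n + 1, cmtr_eq_one_iff.2 (Subgroup.mem_center_iff.1 (hker _ hn) y).symm⟩
  have h2 : π (e ^ j) = 1 := by
    obtain ⟨k, hk⟩ := hQp.exists_pow_eq_one (E.pow_mem heE j)
    exact eq_one_of_pow_eq_one_of_coprime hk
      (by rw [← map_pow, pow_orderOf_eq_one, map_one]) hj
  have h3 : π (e ^ i * e ^ j) = 1 := by
    rw [map_mul, h2, mul_one]
    exact (QuotientGroup.eq_one_iff _).2 h1
  rwa [hij] at h3

theorem card_center_le {b k : ℕ} (hb : 0 < b) (hcard : ∀ p, p.Prime → Nat.card (pcore p G) ≤ b)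
    (hbot : ∀ p, p.Prime → k < p → pcore p G = ⊥) :
    Nat.card (Subgroup.center G) ≤ b ^ (k + 1) := by
  refine card_le_pow_of_sylow_le hb ?_ ?_
  · intro p hp hd
    have : Fact p.Prime := ⟨hp⟩
    obtain ⟨z, hz⟩ := exists_prime_orderOf_dvd_card' (G := Subgroup.center G) p hd
    by_contra hk
    have h1 : (z : G) ∈ pcore p G := mem_pcore_of_mem_center z.2 ⟨1, by
      rw [pow_one, ← hz, ← Subgroup.orderOf_coe, pow_orderOf_eq_one]⟩
    rw [hbot p hp (by omega), Subgroup.mem_bot] at h1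
    have h2 : z = 1 := Subtype.ext h1
    rw [h2, orderOf_one] at hz
    exact hp.one_lt.ne hz
  · intro p hp P
    have : Fact p.Prime := ⟨hp⟩
    refine le_trans ?_ (hcard p hp)
    refine Nat.card_le_card_of_injective
      (fun x : P => (⟨((x : Subgroup.center G) : G), mem_pcore_of_mem_center x.1.2 ?_⟩ :
        pcore p G)) ?_
    · obtain ⟨k, hk⟩ := P.2.exists_pow_eq_one x.2
      exact ⟨k, by simpa using congrArg Subtype.val hk⟩
    · intro x y hxy
      have hval := congrArg Subtype.val hxy
      exact Subtype.ext (Subtype.ext hval)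

end CenterlessBound

theorem IndexBound.exists_card_le_of_center_eq_bot {m h : ℕ} (hT : IndexBound.{u} m h) :
    ∃ B, ∀ (G : Type u) [Group G] [Finite G], HasSinks (m + 1) G → Subgroup.center G = ⊥ →
      Nat.card G ≤ B := by
  classical
  obtain ⟨B, hB0, hB⟩ := hT.exists_card_le_of_pcore_eq_bot
  set M := m + 1 with hM
  set K := M ^ M * (M * M * M) with hK
  set b := M ^ (K ^ K * M) with hb
  have hb0 : 0 < b := by positivity
  set s := (M + 1) * b with hs
  have hs0 : 0 < s := by positivity
  refine ⟨b ^ (M + 1) * B * s ^ s, ?_⟩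
  intro G _ _ hG hZ
  have := Fintype.ofFinite G
  have hcard : ∀ p, p.Prime → Nat.card (pcore p G) ≤ b := fun p hp => by
    have : Fact p.Prime := ⟨hp⟩
    exact card_pcore_le hG hZ hK
  have hbot : ∀ p, p.Prime → M < p → pcore p G = ⊥ := fun p hp => by
    have : Fact p.Prime := ⟨hp⟩
    exact pcore_eq_bot_of_lt hG hZ
  set S : Finset G := ((Finset.range (M + 1)).filter Nat.Prime).biUnion
    fun p => Finset.univ.filter (· ∈ pcore p G) with hS
  have hSconj : ∀ g, ∀ x ∈ S, g⁻¹ * x * g ∈ S := by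
    intro g x hx
    obtain ⟨p, hp, hx⟩ := Finset.mem_biUnion.1 hx
    refine Finset.mem_biUnion.2 ⟨p, hp, ?_⟩
    rw [Finset.mem_filter] at hx ⊢
    exact ⟨Finset.mem_univ _, by simpa using (pcore_normal p).conj_mem x hx.2 g⁻¹⟩
  have hScard : S.card ≤ s := by
    refine (Finset.card_biUnion_le_card_mul _ _ b fun p hp => ?_).trans
      (Nat.mul_le_mul_right _ ((Finset.card_filter_le _ _).trans (Finset.card_range _).le))
    rw [Finset.mem_filter] at hp
    refine le_trans (le_of_eq ?_) (hcard p hp.2)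
    rw [Nat.card_eq_fintype_card, Fintype.card_subtype]
  set C := Subgroup.centralizer (S : Set G) with hC
  have hCn : C.Normal := normal_centralizer_of_forall_conj_mem hSconj
  have hCi : C.index ≤ s ^ s :=
    (index_centralizer_le_of_forall_conj_mem S hSconj).trans
      ((Nat.pow_le_pow_left hScard _).trans (Nat.pow_le_pow_right hs0 hScard))
  have hsub : ∀ p (x : C), x ∈ pcore p C → (x : G) ∈ pcore p G := fun p x hx =>
    map_subtype_pcore_le p C ⟨x, hx, rfl⟩
  have hcentral : ∀ q, q.Prime → pcore q C ≤ Subgroup.center C := by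
    intro q hq x hx
    have hx' := hsub q x hx
    by_cases hqM : M < q
    · rw [hbot q hq hqM, Subgroup.mem_bot] at hx'
      rw [Subtype.ext (a2 := (1 : C)) hx']
      exact one_mem _
    · rw [Subgroup.mem_center_iff]
      intro y
      refine Subtype.ext (Subgroup.mem_centralizer_iff.1 y.2 x ?_).symm
      refine Finset.mem_coe.2 (Finset.mem_biUnion.2 ⟨q, ?_, by simpa using hx'⟩)
      rw [Finset.mem_filter, Finset.mem_range]
      exact ⟨by omega, hq⟩
  have h1 : Nat.card (Subgroup.center C) ≤ b ^ (M + 1) := by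
    refine card_center_le hb0 (fun p hp => ?_) fun p hp hpM => ?_
    · refine le_trans ?_ (hcard p hp)
      refine Nat.card_le_card_of_injective
        (fun x : pcore p C => (⟨x, hsub p x x.2⟩ : pcore p G)) ?_
      intro x y hxy
      have hval := congrArg Subtype.val hxy
      exact Subtype.ext (Subtype.ext hval)
    · rw [Subgroup.eq_bot_iff_forall]
      intro x hx
      have hx' := hsub p x hx
      rw [hbot p hp hpM, Subgroup.mem_bot] at hx'
      exact Subtype.ext hx'
  have h2 : (Subgroup.center C).index ≤ B :=
    hB (C ⧸ Subgroup.center C) ((hG.subgroup C).quotient _)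
      fun q hq => pcore_quotient_center_eq_bot hcentral hq
  calc Nat.card G = Nat.card (Subgroup.center C) * (Subgroup.center C).index * C.index := by
        rw [Subgroup.card_mul_index, Subgroup.card_mul_index]
    _ ≤ b ^ (M + 1) * B * s ^ s := Nat.mul_le_mul (Nat.mul_le_mul h1 h2) hCi

theorem IndexBound.succ {m h : ℕ} (hT : IndexBound.{u} m h) : ∃ h', IndexBound.{u} (m + 1) h' := by
  obtain ⟨B, hB⟩ := hT.exists_card_le_of_center_eq_bot
  refine ⟨B, ?_⟩
  suffices H : ∀ n, ∀ (G : Type u) [Group G] [Finite G], Nat.card G = n → HasSinks (m + 1) G →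
      ∃ c, (Subgroup.upperCentralSeries G c).index ≤ B from fun G _ _ hG => H _ G rfl hG
  intro n
  induction n using Nat.strong_induction_on with
  | _ n ih =>
    intro G _ _ hn hG
    by_cases hZ : Subgroup.center G = ⊥
    · refine ⟨0, ?_⟩
      rw [Subgroup.upperCentralSeries_zero, Subgroup.index_bot]
      exact hB G hG hZ
    · have hlt : Nat.card (G ⧸ Subgroup.center G) < n := by
        rw [← hn, Subgroup.card_eq_card_quotient_mul_card_subgroup (Subgroup.center G)]
        have h1 : 1 < Nat.card (Subgroup.center G) := by
          rw [Subgroup.one_lt_card_iff_ne_bot]; exact hZ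
        have h2 : 0 < Nat.card (G ⧸ Subgroup.center G) := Nat.card_pos
        nlinarith
      obtain ⟨c, hc⟩ := ih _ hlt (G ⧸ Subgroup.center G) rfl (hG.quotient _)
      refine ⟨c + 1, ?_⟩
      rw [← Subgroup.comap_upperCentralSeries_quotient_center,
        Subgroup.index_comap_of_surjective _ (QuotientGroup.mk'_surjective _)]
      exact hc

theorem exists_indexBound (m : ℕ) : ∃ h, IndexBound.{u} m h := by
  induction m with
  | zero => exact ⟨0, fun G _ _ hG => absurd hG.pos (lt_irrefl 0)⟩
  | succ m ih =>
    obtain ⟨h, hh⟩ := ih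
    exact hh.succ

open scoped commutatorElement

section EngelValues

variable {G : Type*} [Group G]

theorem exists_engel_add_eq [Finite G] (a x : G) :
    ∃ k, 0 < k ∧ ∀ n, Nat.card G ≤ n → engel a x (n + k) = engel a x n := by
  have := Fintype.ofFinite G
  obtain ⟨i, j, hij, he⟩ : ∃ i j : Fin (Nat.card G + 1), i ≠ j ∧ engel a x i = engel a x j :=
    Fintype.exists_ne_map_eq_of_card_lt (fun i : Fin (Nat.card G + 1) => engel a x i) (by simp)
  wlog hlt : i < j generalizing i j
  · exact this j i hij.symm he.symm (lt_of_le_of_ne (not_lt.1 hlt) hij.symm)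
  have hlt' : (i : ℕ) < j := hlt
  refine ⟨j - i, by omega, fun n hn => ?_⟩
  obtain ⟨d, rfl⟩ : ∃ d, n = i + d := ⟨n - i, by have := i.2; omega⟩
  rw [show (i : ℕ) + d + (j - i) = j + d by omega, engel_add, engel_add, he]

variable {A : Subgroup G} [hAn : A.Normal]

theorem engel_mem_of_normal {a : G} (ha : a ∈ A) (x : G) (n : ℕ) : engel a x n ∈ A :=
  engel_mem ha (fun d hd => by simpa using hAn.conj_mem d hd x⁻¹) n

theorem engel_pow_of_mem (hA : ∀ a ∈ A, ∀ b ∈ A, a * b = b * a) {a : G} (ha : a ∈ A) (x : G)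
    (i n : ℕ) : engel (a ^ i) x n = engel a x n ^ i := by
  induction n with
  | zero => rfl
  | succ n ih =>
    rw [engel, ih, engel]
    have hb := engel_mem_of_normal ha x n
    generalize engel a x n = b at hb
    have hc : Commute b⁻¹ (x⁻¹ * b * x) :=
      hA _ (A.inv_mem hb) _ (by simpa using hAn.conj_mem b hb x⁻¹)
    have h1 : cmtr b x = b⁻¹ * (x⁻¹ * b * x) := by simp only [cmtr]; group
    have h2 : (x⁻¹ * b * x) ^ i = x⁻¹ * b ^ i * x := by
      simpa using conj_pow (i := i) (a := x⁻¹) (b := b)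
    rw [h1, hc.mul_pow, h2, cmtr, inv_pow]
    group

theorem engel_mul_right_of_mem (hA : ∀ a ∈ A, ∀ b ∈ A, a * b = b * a) {w : G} (hw : w ∈ A) (x : G)
    (n : ℕ) : engel x (x * w) (n + 1) = (engel w x (n + 1))⁻¹ := by
  induction n with
  | zero => simp only [engel, cmtr]; group
  | succ n ih =>
    rw [engel, ih]
    change _ = (cmtr (engel w x (n + 1)) x)⁻¹
    have hb := engel_mem_of_normal hw x (n + 1)
    generalize engel w x (n + 1) = b at hb
    have h1 : x⁻¹ * b⁻¹ * x ∈ A := by simpa using hAn.conj_mem b⁻¹ (A.inv_mem hb) x⁻¹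
    calc cmtr b⁻¹ (x * w) = b * (w⁻¹ * ((x⁻¹ * b⁻¹ * x) * w)) := by simp only [cmtr]; group
      _ = b * (x⁻¹ * b⁻¹ * x) := by rw [hA _ h1 _ hw]; group
      _ = (x⁻¹ * b⁻¹ * x) * b := hA _ hb _ h1
      _ = (cmtr b x)⁻¹ := by simp only [cmtr]; group

/-- In a normal abelian subgroup, elements fixed by an iterated commutation map have bounded
order. -/
theorem orderOf_le_of_engel_eq {m : ℕ} (hG : HasSinks m G)
    (hA : ∀ a ∈ A, ∀ b ∈ A, a * b = b * a) {z x : G} (hz : z ∈ A) {k : ℕ} (hk : 0 < k)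
    (h : engel z x k = z) : orderOf z ≤ m := by
  classical
  obtain ⟨R, hR, N, hN⟩ := hG x
  have hj : ∀ j, engel z x (j * k) = z := by
    intro j
    induction j with
    | zero => simp [engel]
    | succ j ih => rw [add_mul, one_mul, engel_add, ih, h]
  obtain ⟨n, hn⟩ : ∃ n, (N + 1) * k = n + 1 := Nat.exists_eq_succ_of_ne_zero (by positivity)
  have hNn : N ≤ n := by nlinarith
  have hmem : ∀ i : ℕ, (z ^ i)⁻¹ ∈ R := by
    intro i
    have h1 := hN (x * z ^ i) (n + 1) (by omega)
    rwa [engel_mul_right_of_mem hA (A.pow_mem hz i), engel_pow_of_mem hA hz, ← hn, hj] at h1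
  refine le_trans ?_ hR
  rw [← Finset.card_range (orderOf z)]
  refine Finset.card_le_card_of_injOn (fun i => (z ^ i)⁻¹) (fun i _ => hmem i) ?_
  intro i hi j hj hij
  exact pow_injOn_Iio_orderOf (by simpa using hi) (by simpa using hj) (inv_injective hij)

end EngelValues

theorem isNilpotent_of_engel {G : Type*} [Group G] [Finite G]
    (h : ∀ a x : G, ∃ n, engel a x n = 1) : Group.IsNilpotent G := by
  have hiff : Group.IsNilpotent G ↔
      ∀ (p : ℕ), Fact p.Prime → ∀ P : Sylow p G, (P : Subgroup G).Normal :=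
    Group.isNilpotent_of_finite_tfae.out 0 3
  refine hiff.2 fun p _ P => ?_
  have hP : (P : Subgroup G) ≤ pcore p G := by
    intro y hy
    refine mem_pcore_of_engel (D := {g : G | ∃ k, g ^ p ^ k = 1}) ?_ (fun y hy => hy)
      (fun y _ w _ => h w y) (P.2.exists_pow_eq_one hy)
    rintro g y ⟨k, hk⟩
    exact ⟨k, by rw [conj_pow, hk, mul_one, mul_inv_cancel]⟩
  rw [← P.is_maximal' (isPGroup_pcore p) hP]
  exact pcore_normal p

theorem card_commutatorSet_le_index_center_sq (G : Type*) [Group G] [Finite G] :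
    Nat.card (commutatorSet G) ≤ (Subgroup.center G).index ^ 2 := by
  classical
  have hc : ∀ z ∈ Subgroup.center G, ∀ t y : G, ⁅z * t, y⁆ = ⁅t, y⁆ := by
    intro z hz t y
    rw [commutatorElement_def, commutatorElement_def]
    calc z * t * y * (z * t)⁻¹ * y⁻¹ = z * (t * y * t⁻¹) * z⁻¹ * y⁻¹ := by group
      _ = t * y * t⁻¹ * y⁻¹ := by rw [← Subgroup.mem_center_iff.1 hz]; group
  obtain ⟨T, hT, -, hTZ⟩ := (Subgroup.center G).exists_finset_transversal ⊤
  rw [Subgroup.relIndex_top_right] at hT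
  have hsub : commutatorSet G ⊆ ((T ×ˢ T).image fun q => ⁅q.1, q.2⁆ : Finset G) := by
    rintro _ ⟨a, b, rfl⟩
    obtain ⟨t, ht, hat⟩ := hTZ a trivial
    obtain ⟨u, hu, hbu⟩ := hTZ b trivial
    refine Finset.mem_coe.2 (Finset.mem_image.2 ⟨(t, u), Finset.mem_product.2 ⟨ht, hu⟩, ?_⟩)
    have h1 := hc _ hat t b
    have h2 := hc _ hbu u t
    rw [inv_mul_cancel_right] at h1 h2
    rw [h1, ← commutatorElement_inv, ← commutatorElement_inv b t, h2]
  rw [Nat.card_coe_set_eq]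
  refine (Set.ncard_le_ncard hsub (Finset.finite_toSet _)).trans ?_
  rw [Set.ncard_coe_finset, sq]
  refine Finset.card_image_le.trans ?_
  rw [Finset.card_product]
  exact Nat.mul_le_mul hT hT

theorem card_commutator_le_of_index_center_le {G : Type*} [Group G] [Finite G] {b : ℕ}
    (hb : (Subgroup.center G).index ≤ b) :
    Nat.card (commutator G) ≤ b ^ (b * b ^ 2 + 1) := by
  have hpos : 0 < (Subgroup.center G).index := Nat.pos_of_ne_zero Subgroup.index_ne_zero_of_finite
  refine (Nat.le_of_dvd (by positivity) (Subgroup.card_commutator_dvd_index_center_pow G)).trans ?_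
  refine (Nat.pow_le_pow_left hb _).trans (Nat.pow_le_pow_right (by omega) ?_)
  exact Nat.succ_le_succ (Nat.mul_le_mul hb
    ((card_commutatorSet_le_index_center_sq G).trans (Nat.pow_le_pow_left hb 2)))

theorem card_closure_le_of_orderOf_abelianization_le {G : Type*} [Group G] [Finite G] (S : Finset G)
    {b e : ℕ} (hb : (Subgroup.centralizer (S : Set G)).index ≤ b) (he0 : 0 < e)
    (he : ∀ s (hs : s ∈ Subgroup.closure (S : Set G)), s ∈ S →
      orderOf (Abelianization.of (⟨s, hs⟩ : Subgroup.closure (S : Set G))) ≤ e) :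
    Nat.card (Subgroup.closure (S : Set G)) ≤ b ^ (b * b ^ 2 + 1) * e ^ S.card := by
  classical
  have := Fintype.ofFinite G
  set N := Subgroup.closure (S : Set G) with hN
  have h1 : (Subgroup.center N).index ≤ b := by
    have hle : (Subgroup.centralizer (S : Set G)).subgroupOf N ≤ Subgroup.center N := by
      intro c hc
      rw [Subgroup.mem_subgroupOf, ← Subgroup.centralizer_closure] at hc
      rw [Subgroup.mem_center_iff]
      exact fun y => Subtype.ext (Subgroup.mem_centralizer_iff.1 hc y y.2)
    refine (Nat.le_of_dvd (Nat.pos_of_ne_zero Subgroup.index_ne_zero_of_finite)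
      (Subgroup.index_dvd_of_le hle)).trans (le_trans ?_ hb)
    have h2 := Subgroup.relIndex_mono_right (Subgroup.centralizer (S : Set G)) (le_top (a := N))
    rwa [Subgroup.relIndex_top_right] at h2
  rw [← Subgroup.card_mul_index (commutator N)]
  refine Nat.mul_le_mul (card_commutator_le_of_index_center_le h1) ?_
  set S' : Finset N := Finset.univ.filter fun s => (s : G) ∈ S with hS'
  have hS'card : S'.card ≤ S.card :=
    Finset.card_le_card_of_injOn Subtype.val (fun s hs => by simpa [S'] using hs)
      Subtype.val_injective.injOn
  have htop : Subgroup.closure ((S'.image Abelianization.of : Finset (Abelianization N)) :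
      Set (Abelianization N)) = ⊤ := by
    have h2 : (S' : Set N) = Subtype.val ⁻¹' (S : Set G) := by ext; simp [S']
    rw [Finset.coe_image, ← MonoidHom.map_closure, h2, Subgroup.closure_closure_coe_preimage,
      ← MonoidHom.range_eq_map, MonoidHom.range_eq_top]
    exact QuotientGroup.mk'_surjective _
  have h3 := card_closure_le_of_orderOf_le (e := e) (S'.image Abelianization.of) (by
    intro a ha
    obtain ⟨s, hs, rfl⟩ := Finset.mem_image.1 ha
    exact he s s.2 (Finset.mem_filter.1 hs).2)
  rw [htop, Subgroup.card_top] at h3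
  exact h3.trans (Nat.pow_le_pow_right he0 (Finset.card_image_le.trans hS'card))

theorem exists_finset_engel {G : Type*} [Group G] [Finite G] {m t c : ℕ} (hG : HasSinks m G)
    (hc : (Subgroup.upperCentralSeries G c).index ≤ t) :
    ∃ (S : Finset G) (n₁ : ℕ), S.card ≤ t * m ∧ Nat.card G ≤ n₁ ∧
      (∀ q x n, n₁ ≤ n → engel q x n ∈ S) ∧
      ∀ s ∈ S, ∃ q x n, n₁ ≤ n ∧ s = engel q x n := by
  classical
  obtain ⟨T, hT, -, hTZ⟩ := (Subgroup.upperCentralSeries G c).exists_finset_transversal ⊤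
  rw [Subgroup.relIndex_top_right] at hT
  choose R hR N hN using hG
  set n₁ := Nat.card G + c + ∑ r ∈ T, N r with hn₁
  refine ⟨(T.biUnion R).filter fun s => ∃ q x n, n₁ ≤ n ∧ s = engel q x n, n₁, ?_, ?_, ?_, ?_⟩
  · exact (Finset.card_filter_le _ _).trans
      ((Finset.card_biUnion_le_card_mul T R m fun r _ => hR r).trans
        (Nat.mul_le_mul_right _ (hT.trans hc)))
  · omega
  · intro q x n hn
    refine Finset.mem_filter.2 ⟨?_, q, x, n, hn, rfl⟩
    obtain ⟨r, hr, hqr⟩ := hTZ q trivial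
    refine Finset.mem_biUnion.2 ⟨r, hr, ?_⟩
    have h1 : r⁻¹ * q ∈ Subgroup.upperCentralSeries G c := by
      have h2 : (Subgroup.upperCentralSeries G c).Normal := inferInstance
      simpa [mul_assoc] using h2.conj_mem _ hqr r⁻¹
    rw [← engel_eq_engel_of_inv_mul_mem h1 x (by omega)]
    refine hN r x n ?_
    have := Finset.single_le_sum (f := N) (fun _ _ => Nat.zero_le _) hr
    omega
  · intro s hs
    exact (Finset.mem_filter.1 hs).2

theorem IndexBound.exists_normal_isNilpotent_quotient {m h : ℕ} (hT : IndexBound.{u} m h) :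
    ∃ B, ∀ (G : Type u) [Group G] [Finite G], HasSinks m G →
      ∃ N : Subgroup G, N.Normal ∧ Nat.card N ≤ B ∧ ∀ [N.Normal], Group.IsNilpotent (G ⧸ N) := by
  set s := h * m + 1 with hs
  set b := s ^ s with hb
  refine ⟨b ^ (b * b ^ 2 + 1) * m ^ s, ?_⟩
  intro G _ _ hG
  obtain ⟨c, hc⟩ := hT G hG
  obtain ⟨S, n₁, hScard, hn₁, hmem, hS⟩ := exists_finset_engel hG hc
  replace hScard : S.card ≤ s := by omega
  have hSconj : ∀ g, ∀ y ∈ S, g⁻¹ * y * g ∈ S := by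
    intro g y hy
    obtain ⟨q, x, n, hn, rfl⟩ := hS y hy
    have h1 := conj_engel g⁻¹ q x n
    rw [inv_inv] at h1
    rw [h1]
    exact hmem _ _ _ hn
  set N := Subgroup.closure (S : Set G) with hN
  have hNn : N.Normal := by
    refine Subgroup.normalizer_eq_top_iff.1 (top_le_iff.1 fun g _ =>
      Subgroup.normalizer_le_normalizer_closure _ (Subgroup.mem_set_normalizer_iff.2 fun y =>
        ⟨fun hy => ?_, fun hy => ?_⟩))
    · simpa using hSconj g⁻¹ y hy
    · simpa [mul_assoc] using hSconj g _ hy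
  refine ⟨N, hNn, ?_, ?_⟩
  · have hi : (Subgroup.centralizer (S : Set G)).index ≤ b :=
      (index_centralizer_le_of_forall_conj_mem S hSconj).trans
        ((Nat.pow_le_pow_left hScard _).trans (Nat.pow_le_pow_right (Nat.succ_pos _) hScard))
    refine (card_closure_le_of_orderOf_abelianization_le S hi hG.pos ?_).trans
      (Nat.mul_le_mul_left _ (Nat.pow_le_pow_right hG.pos hScard))
    intro y hy hyS
    have hCn : (⁅N, N⁆ : Subgroup G).Normal := inferInstance
    set π := QuotientGroup.mk' (⁅N, N⁆ : Subgroup G) with hπ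
    have hAn : (N.map π).Normal := hNn.map π (QuotientGroup.mk'_surjective _)
    have hA : ∀ a ∈ N.map π, ∀ b ∈ N.map π, a * b = b * a := by
      rintro _ ⟨a, ha, rfl⟩ _ ⟨b, hb, rfl⟩
      have h1 : π ⁅a, b⁆ = 1 :=
        (QuotientGroup.eq_one_iff _).2 (Subgroup.commutator_mem_commutator ha hb)
      rwa [map_commutatorElement, commutatorElement_eq_one_iff_mul_comm] at h1
    obtain ⟨q, x, n, hn, rfl⟩ := hS y hyS
    obtain ⟨k, hk, hkx⟩ := exists_engel_add_eq q x
    have h1 : engel (π (engel q x n)) (π x) k = π (engel q x n) := by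
      rw [← map_engel, ← engel_add, hkx n (hn₁.trans hn)]
    have h2 := orderOf_le_of_engel_eq (hG.quotient ⁅N, N⁆) hA
      (Subgroup.mem_map_of_mem π hy) hk h1
    refine le_trans (orderOf_le_of_pow_eq_one (orderOf_pos (π (engel q x n))) ?_) h2
    have h3 : π (engel q x n ^ orderOf (π (engel q x n))) = 1 := by
      rw [map_pow, pow_orderOf_eq_one]
    have h4 : engel q x n ^ orderOf (π (engel q x n)) ∈ ⁅N, N⁆ := (QuotientGroup.eq_one_iff _).1 h3
    obtain ⟨y, hy', hyeq⟩ : _ ∈ (commutator N).map N.subtype :=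
      by rw [Subgroup.map_subtype_commutator]; exact h4
    rw [← map_pow, ← MonoidHom.mem_ker, Abelianization.ker_of]
    have h5 : y = (⟨engel q x n, hy⟩ : N) ^ orderOf (π (engel q x n)) := Subtype.ext hyeq
    rw [← h5]
    exact hy'
  · intro _
    refine isNilpotent_of_engel fun a x => ?_
    obtain ⟨a, rfl⟩ := QuotientGroup.mk'_surjective N a
    obtain ⟨x, rfl⟩ := QuotientGroup.mk'_surjective N x
    refine ⟨n₁, ?_⟩
    rw [← map_engel]
    exact (QuotientGroup.eq_one_iff _).2 (Subgroup.subset_closure (hmem a x n₁ le_rfl))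

end BoundedSinks

/-- In a finite group in which every element has a right Engel sink of size at most `m`,
there is a normal subgroup of `m`-bounded order with nilpotent quotient. -/
theorem finite_bounded_right_engel_sinks :
    ∃ f : ℕ → ℕ, ∀ (m : ℕ), 0 < m →
      ∀ (G : Type u) [Group G] [Finite G],
      (∀ g : G, ∃ R : Finset G, R.card ≤ m ∧ IsRightEngelSink g ↑R) →
      ∃ N : Subgroup G, N.Normal ∧ Nat.card N ≤ f m ∧
        ∀ [N.Normal], Group.IsNilpotent (G ⧸ N) := by
  have hB := fun m => (exists_indexBound.{u} m).choose_spec.exists_normal_isNilpotent_quotient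
  choose f hf using hB
  exact ⟨f, fun m _ G _ _ hG => hf m G (hasSinks_of_isRightEngelSink hG)⟩
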